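/- arXiv:2508.02030 — 9 statements merged into one kernel-verified Lean document; each statement's English description precedes it below -/
import Mathlib

section
/- Let n ≥ 1, let π be a permutation of Fin n, and let T be any set of cells reachable from the graph G(π) by finitely many percolation steps. Then for every row index i, the set {j : (i,j) ∈ T} is a nonempty set of consecutive values (an interval), and for every column index j, the set {i : (i,j) ∈ T} is a nonempty interval. -/
/-- Two cells of the `n × n` board are cardinal (north/south/east/west) neighbors. -/
def Adj {n : ℕ} (c d : Fin n × Fin n) : Prop :=
  (c.1 = d.1 ∧ ((c.2 : ℕ) + 1 = (d.2 : ℕ) ∨ (d.2 : ℕ) + 1 = (c.2 : ℕ))) ∨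
  (c.2 = d.2 ∧ ((c.1 : ℕ) + 1 = (d.1 : ℕ) ∨ (d.1 : ℕ) + 1 = (c.1 : ℕ)))

/-- A cell `c` is mutable for a set `T` of cells: `c ∉ T` and at least two of its
cardinal neighbors belong to `T`. -/
def IsMutable {n : ℕ} (T : Set (Fin n × Fin n)) (c : Fin n × Fin n) : Prop :=
  c ∉ T ∧ ∃ d ∈ T, ∃ e ∈ T, d ≠ e ∧ Adj c d ∧ Adj c e

/-- One percolation step: adjoin a single mutable cell. -/
def PercStep {n : ℕ} (T T' : Set (Fin n × Fin n)) : Prop :=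
  ∃ c, IsMutable T c ∧ T' = T ∪ {c}

/-- The graph of a permutation `π`, i.e. the set of cells `(i, π i)`. -/
def graphOf {n : ℕ} (π : Equiv.Perm (Fin n)) : Set (Fin n × Fin n) :=
  {p | p.2 = π p.1}

/-- A set of cells is percolation-closed if it contains every cell having at least two
cardinal neighbors in the set. -/
def PercClosed {n : ℕ} (S : Set (Fin n × Fin n)) : Prop :=
  ∀ c, (∃ d ∈ S, ∃ e ∈ S, d ≠ e ∧ Adj c d ∧ Adj c e) → c ∈ S

/-- The percolation closure of `π`: the smallest percolation-closed set containing the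
graph of `π`. -/
def percClosure {n : ℕ} (π : Equiv.Perm (Fin n)) : Set (Fin n × Fin n) :=
  ⋂₀ {S | graphOf π ⊆ S ∧ PercClosed S}

/-- `π` is full if its percolation closure is the whole board. -/
def Full {n : ℕ} (π : Equiv.Perm (Fin n)) : Prop :=
  percClosure π = Set.univ

/-- A permutation of `Fin m` is indecomposable if it maps no proper initial segment
`{0, …, k−1}` (with `1 ≤ k < m`) onto itself. -/
def Indecomposable {m : ℕ} (σ : Equiv.Perm (Fin m)) : Prop :=
  ¬ ∃ k, 1 ≤ k ∧ k < m ∧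
    (fun i => σ i) '' {i : Fin m | (i : ℕ) < k} = {i : Fin m | (i : ℕ) < k}

/-- `π` is no-growth if no cell is mutable for its graph. -/
def NoGrowth {n : ℕ} (π : Equiv.Perm (Fin n)) : Prop :=
  ∀ c, ¬ IsMutable (graphOf π) c

theorem aux_ext {n : ℕ} (P : Fin n → Prop)
    (hP : ∀ a b x : Fin n, P a → P b → a ≤ x → x ≤ b → P x) (k m : Fin n) (hm : P m)
    (hk : (k : ℕ) + 1 = m ∨ (m : ℕ) + 1 = k) (a b x : Fin n)
    (ha : P a ∨ a = k) (hb : P b ∨ b = k) (hax : a ≤ x) (hxb : x ≤ b) : P x ∨ x = k := by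
  by_cases hx : x = k
  · exact Or.inr hx
  · left
    have hx' : (x : ℕ) ≠ k := fun h => hx (Fin.ext h)
    rw [Fin.le_def] at hax hxb
    rcases ha with ha | rfl <;> rcases hb with hb | rfl
    · exact hP a b x ha hb hax hxb
    · exact hP a m x ha hm hax (by rw [Fin.le_def]; omega)
    · exact hP m b x hm hb (by rw [Fin.le_def]; omega) hxb
    · omega

theorem aux_split {n : ℕ} (P : Fin n → Prop)
    (hP : ∀ a b x : Fin n, P a → P b → a ≤ x → x ≤ b → P x) (k d e : Fin n) (hd : P d) (he : P e)
    (hne : d ≠ e) (h1 : (k : ℕ) + 1 = d ∨ (d : ℕ) + 1 = k) (h2 : (k : ℕ) + 1 = e ∨ (e : ℕ) + 1 = k) :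
    P k := by
  have hne' : (d : ℕ) ≠ e := fun h => hne (Fin.ext h)
  rcases h1 with h1 | h1
  · exact hP e d k he hd (by rw [Fin.le_def]; omega) (by rw [Fin.le_def]; omega)
  · exact hP d e k hd he (by rw [Fin.le_def]; omega) (by rw [Fin.le_def]; omega)

theorem stmt_2 (n : ℕ) (hn : 1 ≤ n) (π : Equiv.Perm (Fin n)) (T : Set (Fin n × Fin n))
    (hreach : Relation.ReflTransGen PercStep (graphOf π) T) :
    (∀ i : Fin n, (∃ j : Fin n, (i, j) ∈ T) ∧
      ∀ j₁ j₂ j : Fin n, (i, j₁) ∈ T → (i, j₂) ∈ T → j₁ ≤ j → j ≤ j₂ → (i, j) ∈ T) ∧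
    (∀ j : Fin n, (∃ i : Fin n, (i, j) ∈ T) ∧
      ∀ i₁ i₂ i : Fin n, (i₁, j) ∈ T → (i₂, j) ∈ T → i₁ ≤ i → i ≤ i₂ → (i, j) ∈ T) := by
  induction hreach with
  | refl =>
    refine ⟨fun i => ⟨⟨π i, rfl⟩, ?_⟩, fun j => ⟨⟨π.symm j, by simp [graphOf]⟩, ?_⟩⟩
    · intro a b x ha hb h1 h2
      simp only [graphOf, Set.mem_ofPred_eq] at *
      subst ha hb
      exact le_antisymm h2 h1
    · intro a b x ha hb h1 h2
      simp only [graphOf, Set.mem_ofPred_eq] at *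
      have : a = b := π.injective (ha.symm.trans hb)
      subst this
      rw [le_antisymm h2 h1]
      exact ha
  | @tail S S2 _ hstep ih =>
    obtain ⟨⟨r, s⟩, ⟨hc, ⟨d1, d2⟩, hd, ⟨e1, e2⟩, he, hne, hcd, hce⟩, rfl⟩ := hstep
    obtain ⟨hR, hC⟩ := ih
    have key : (∃ m, (r, m) ∈ S ∧ ((s : ℕ) + 1 = m ∨ (m : ℕ) + 1 = s)) ∧
        (∃ m, (m, s) ∈ S ∧ ((r : ℕ) + 1 = m ∨ (m : ℕ) + 1 = r)) := by
      simp only [Adj] at hcd hce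
      rcases hcd with ⟨rfl, hcd⟩ | ⟨rfl, hcd⟩ <;> rcases hce with ⟨h, hce⟩ | ⟨h, hce⟩ <;> subst h
      · exact absurd (aux_split (fun x => (r, x) ∈ S) (hR r).2 s d2 e2 hd he
          (fun h => hne (by rw [h])) hcd hce) hc
      · exact ⟨⟨_, hd, hcd⟩, ⟨_, he, hce⟩⟩
      · exact ⟨⟨_, he, hce⟩, ⟨_, hd, hcd⟩⟩
      · exact absurd (aux_split (fun x => (x, s) ∈ S) (hC s).2 r d1 e1 hd he
          (fun h => hne (by rw [h])) hcd hce) hc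
    obtain ⟨⟨m, hm, hms⟩, ⟨l, hl, hlr⟩⟩ := key
    refine ⟨fun i => ⟨(hR i).1.imp fun _ h => Or.inl h, ?_⟩,
      fun j => ⟨(hC j).1.imp fun _ h => Or.inl h, ?_⟩⟩
    · intro a b x ha hb h1 h2
      simp only [Set.mem_union, Set.mem_singleton_iff, Prod.mk.injEq] at *
      by_cases hi : i = r
      · subst hi
        simp only [true_and] at *
        exact aux_ext (fun x => (i, x) ∈ S) (hR i).2 s m hm hms a b x ha hb h1 h2
      · simp only [hi, false_and, or_false] at *
        exact (hR i).2 a b x ha hb h1 h2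
    · intro a b x ha hb h1 h2
      simp only [Set.mem_union, Set.mem_singleton_iff, Prod.mk.injEq] at *
      by_cases hj : j = s
      · subst hj
        simp only [and_true] at *
        exact aux_ext (fun x => (x, j) ∈ S) (hC j).2 r l hl hlr a b x ha hb h1 h2
      · simp only [hj, and_false, or_false] at *
        exact (hC j).2 a b x ha hb h1 h2
end

section
/- Let n ≥ 1 and let π be a permutation of Fin n. Then there exist m with 1 ≤ m ≤ n, positive sizes s : Fin m → ℕ with ∑ s j = n, and row-starting positions r : Fin m → ℕ such that the row intervals [r j, r j + s j) are pairwise disjoint and cover {0,…,n−1}, and, setting the column starts cs j = ∑_{i<j} s i, the percolation closure satisfies C(π) = {(x,y) : ∃ j, r j ≤ x < r j + s j and cs j ≤ y < cs j + s j}. That is, the final configuration of bootstrap percolation consists of square all-ones tiles occupying consecutive blocks of columns, and each row and each column meets exactly one of these square tiles. -/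
theorem aux_line (R : ℕ → ℕ → Prop)
    (hR : ∀ x x' y y', (x' = x + 1 ∨ x = x' + 1) → (y' = y + 1 ∨ y = y' + 1) →
      R x' y → R x y' → R x y)
    (x0 x1 b1 b2 y0 : ℕ) (hx : x1 = x0 + 1 ∨ x0 = x1 + 1)
    (hf : ∀ y, b1 ≤ y → y < b2 → R x1 y) (hb : b1 < b2)
    (h1 : b1 ≤ y0 + 1) (h2 : y0 ≤ b2) (h0 : R x0 y0) :
    ∀ y, b1 ≤ y → y < b2 → R x0 y := by
  have up : ∀ k y, b1 ≤ y + 1 → y + k < b2 → R x0 y → R x0 (y + k) := by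
    intro k
    induction k with
    | zero => intro y _ _ h; exact h
    | succ k ih =>
      intro y ha hb' h
      exact hR x0 x1 (y + (k+1)) (y + k) hx (by omega) (hf _ (by omega) (by omega))
        (ih y ha (by omega) h)
  have down : ∀ k y, b1 ≤ y → y + k ≤ b2 → R x0 (y + k) → R x0 y := by
    intro k
    induction k with
    | zero => intro y _ _ h; exact h
    | succ k ih =>
      intro y ha hb' h
      have := ih (y+1) (by omega) (by omega) (by rwa [show y + 1 + k = y + (k+1) by omega])
      exact hR x0 x1 y (y+1) hx (by omega) (hf _ (by omega) (by omega)) this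
  intro y hy1 hy2
  rcases le_total y0 y with h | h
  · have := up (y - y0) y0 h1 (by omega) h0
    rwa [show y0 + (y - y0) = y by omega] at this
  · exact down (y0 - y) y hy1 (by omega) (by rwa [show y + (y0 - y) = y0 by omega])

def RFill (R : ℕ → ℕ → Prop) (a1 a2 b1 b2 : ℕ) : Prop :=
  ∀ x y, a1 ≤ x → x < a2 → b1 ≤ y → y < b2 → R x y

theorem aux_merge (R : ℕ → ℕ → Prop)
    (hR : ∀ x x' y y', (x' = x + 1 ∨ x = x' + 1) → (y' = y + 1 ∨ y = y' + 1) →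
      R x' y → R x y' → R x y)
    (c1 c2 d1 d2 : ℕ) (hc : c1 < c2) (hd : d1 < d2) (hQ : RFill R c1 c2 d1 d2) :
    ∀ k a1 a2 b1 b2, (a1 - c1) + (c2 - a2) + (b1 - d1) + (d2 - b2) = k →
      a1 < a2 → b1 < b2 → RFill R a1 a2 b1 b2 →
      a1 ≤ c2 → c1 ≤ a2 → b1 ≤ d2 → d1 ≤ b2 →
      RFill R (min a1 c1) (max a2 c2) (min b1 d1) (max b2 d2) := by
  have hR' : ∀ x x' y y', (x' = x + 1 ∨ x = x' + 1) → (y' = y + 1 ∨ y = y' + 1) →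
      R y x' → R y' x → R y x := by
    intro x x' y y' h1 h2 h3 h4
    exact hR y y' x x' h2 h1 h4 h3
  intro k
  induction k with
  | zero =>
    intro a1 a2 b1 b2 hk ha hb hP _ _ _ _ x y _ _ _ _
    exact hP x y (by omega) (by omega) (by omega) (by omega)
  | succ k ih =>
    intro a1 a2 b1 b2 hk ha hb hP t1 t2 t3 t4
    by_cases e1 : a2 < c2
    · have hl := aux_line R hR a2 (a2 - 1) b1 b2 (max d1 (b1 - 1)) (by omega)
        (fun y h h' => hP _ _ (by omega) (by omega) h h') hb (by omega) (by omega)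
        (hQ _ _ (by omega) (by omega) (by omega) (by omega))
      have hP' : RFill R a1 (a2+1) b1 b2 := by
        intro x y q1 q2 q3 q4
        by_cases hx : x = a2
        · subst hx; exact hl y q3 q4
        · exact hP x y q1 (by omega) q3 q4
      have := ih a1 (a2+1) b1 b2 (by omega) (by omega) hb hP' (by omega) (by omega) t3 t4
      rwa [show max (a2+1) c2 = max a2 c2 by omega] at this
    by_cases e2 : c1 < a1
    · have hl := aux_line R hR (a1-1) a1 b1 b2 (max d1 (b1 - 1)) (by omega)
        (fun y h h' => hP _ _ (by omega) (by omega) h h') hb (by omega) (by omega)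
        (hQ _ _ (by omega) (by omega) (by omega) (by omega))
      have hP' : RFill R (a1-1) a2 b1 b2 := by
        intro x y q1 q2 q3 q4
        by_cases hx : x = a1 - 1
        · subst hx; exact hl y q3 q4
        · exact hP x y (by omega) (by omega) q3 q4
      have := ih (a1-1) a2 b1 b2 (by omega) (by omega) hb hP' (by omega) (by omega) t3 t4
      rwa [show min (a1-1) c1 = min a1 c1 by omega] at this
    by_cases e3 : b2 < d2
    · have hl := aux_line (fun x y => R y x) hR' b2 (b2 - 1) a1 a2 (max c1 (a1 - 1)) (by omega)
        (fun y h h' => hP _ _ h h' (by omega) (by omega)) ha (by omega) (by omega)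
        (hQ _ _ (by omega) (by omega) (by omega) (by omega))
      have hP' : RFill R a1 a2 b1 (b2+1) := by
        intro x y q1 q2 q3 q4
        by_cases hx : y = b2
        · subst hx; exact hl x q1 q2
        · exact hP x y q1 q2 q3 (by omega)
      have := ih a1 a2 b1 (b2+1) (by omega) ha (by omega) hP' t1 t2 (by omega) (by omega)
      rwa [show max (b2+1) d2 = max b2 d2 by omega] at this
    · have hl := aux_line (fun x y => R y x) hR' (b1-1) b1 a1 a2 (max c1 (a1 - 1)) (by omega)
        (fun y h h' => hP _ _ h h' (by omega) (by omega)) ha (by omega) (by omega)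
        (hQ _ _ (by omega) (by omega) (by omega) (by omega))
      have hP' : RFill R a1 a2 (b1-1) b2 := by
        intro x y q1 q2 q3 q4
        by_cases hx : y = b1 - 1
        · subst hx; exact hl x q1 q2
        · exact hP x y q1 q2 (by omega) q4
      have := ih a1 a2 (b1-1) b2 (by omega) ha (by omega) hP' t1 t2 (by omega) (by omega)
      rwa [show min (b1-1) d1 = min b1 d1 by omega] at this

def TR {n : ℕ} (π : Equiv.Perm (Fin n)) (x y : ℕ) : Prop :=
  ∃ (hx : x < n) (hy : y < n), ((⟨x, hx⟩, ⟨y, hy⟩) : Fin n × Fin n) ∈ percClosure π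

theorem closure_closed {n : ℕ} (π : Equiv.Perm (Fin n)) : PercClosed (percClosure π) := by
  rintro c ⟨d, hd, e, he, hne, h1, h2⟩ S hS
  exact hS.2 c ⟨d, hd S hS, e, he S hS, hne, h1, h2⟩

theorem TR_mix {n : ℕ} (π : Equiv.Perm (Fin n)) :
    ∀ x x' y y', (x' = x + 1 ∨ x = x' + 1) → (y' = y + 1 ∨ y = y' + 1) →
      TR π x' y → TR π x y' → TR π x y := by
  rintro x x' y y' h1 h2 ⟨hx', hy, h3⟩ ⟨hx, hy', h4⟩
  refine ⟨hx, hy, closure_closed π _ ⟨_, h3, _, h4, ?_, ?_, ?_⟩⟩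
  · intro h
    simp only [Prod.mk.injEq, Fin.mk.injEq] at h
    omega
  · right; refine ⟨rfl, ?_⟩; simp only; omega
  · left; refine ⟨rfl, ?_⟩; simp only; omega

def Good {n : ℕ} (π : Equiv.Perm (Fin n)) (a1 a2 b1 b2 : ℕ) : Prop :=
  a1 < a2 ∧ a2 ≤ n ∧ b1 < b2 ∧ b2 ≤ n ∧
  (∀ x : Fin n, (a1 ≤ (x:ℕ) ∧ (x:ℕ) < a2) ↔ (b1 ≤ (π x : ℕ) ∧ (π x : ℕ) < b2)) ∧
  RFill (TR π) a1 a2 b1 b2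

theorem Good.merge {n : ℕ} {π : Equiv.Perm (Fin n)} {a1 a2 b1 b2 c1 c2 d1 d2 : ℕ}
    (hP : Good π a1 a2 b1 b2) (hQ : Good π c1 c2 d1 d2)
    (t1 : a1 ≤ c2) (t2 : c1 ≤ a2) (t3 : b1 ≤ d2) (t4 : d1 ≤ b2) :
    Good π (min a1 c1) (max a2 c2) (min b1 d1) (max b2 d2) := by
  obtain ⟨p1, p2, p3, p4, p5, p6⟩ := hP
  obtain ⟨q1, q2, q3, q4, q5, q6⟩ := hQ
  refine ⟨by omega, by omega, by omega, by omega, ?_,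
    aux_merge _ (TR_mix π) c1 c2 d1 d2 q1 q3 q6 _ a1 a2 b1 b2 rfl p1 p3 p6 t1 t2 t3 t4⟩
  intro x
  have h1 := p5 x
  have h2 := q5 x
  omega

theorem card_int (n a b : ℕ) (hb : b ≤ n) :
    (Finset.univ.filter (fun x : Fin n => a ≤ (x:ℕ) ∧ (x:ℕ) < b)).card = b - a := by
  rw [← Nat.card_Ico, ← Finset.card_map Fin.valEmbedding]
  congr 1
  ext x
  simp only [Finset.mem_map, Finset.mem_filter, Finset.mem_univ, true_and, Fin.valEmbedding_apply,
    Finset.mem_Ico]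
  constructor
  · rintro ⟨a, h, rfl⟩; exact h
  · intro h; exact ⟨⟨x, by omega⟩, h, rfl⟩

theorem Good.size {n : ℕ} {π : Equiv.Perm (Fin n)} {a1 a2 b1 b2 : ℕ}
    (hP : Good π a1 a2 b1 b2) : a2 - a1 = b2 - b1 := by
  obtain ⟨p1, p2, p3, p4, p5, p6⟩ := hP
  rw [← card_int n a1 a2 p2, ← card_int n b1 b2 p4, ← Finset.card_map π.toEmbedding]
  congr 1
  ext y
  simp only [Finset.mem_map, Finset.mem_filter, Finset.mem_univ, true_and, Equiv.coe_toEmbedding]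
  constructor
  · rintro ⟨x, h, rfl⟩; exact (p5 x).1 h
  · intro h; exact ⟨π.symm y, (p5 _).2 (by simpa using h), by simp⟩

theorem Good.single {n : ℕ} (π : Equiv.Perm (Fin n)) (x : Fin n) :
    Good π x (x+1) (π x) (π x + 1) := by
  refine ⟨by omega, by omega, by omega, by omega, ?_, ?_⟩
  · intro z
    constructor
    · intro h
      have : z = x := by ext; omega
      subst this; omega
    · intro h
      have : π z = π x := by ext; omega
      have := π.injective this
      subst this; omega
  · intro u v h1 h2 h3 h4
    have hu : u = x := by omega
    have hv : v = π x := by omega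
    subst hu; subst hv
    refine ⟨x.2, (π x).2, ?_⟩
    intro S hS
    exact hS.1 rfl

theorem exists_max {n : ℕ} (π : Equiv.Perm (Fin n)) (y : ℕ) : ∃ a1 a2 b1 b2, y < n →
    (Good π a1 a2 b1 b2 ∧ b1 ≤ y ∧ y < b2 ∧ ∀ c1 c2 d1 d2, Good π c1 c2 d1 d2 →
      a1 ≤ c2 → c1 ≤ a2 → b1 ≤ d2 → d1 ≤ b2 → a1 ≤ c1 ∧ c2 ≤ a2 ∧ b1 ≤ d1 ∧ d2 ≤ b2) := by
  classical
  by_cases hy : y < n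
  swap
  · exact ⟨0, 0, 0, 0, fun h => absurd h hy⟩
  let p : ℕ → Prop := fun k => ∃ a1 a2 b1 b2, Good π a1 a2 b1 b2 ∧ b1 ≤ y ∧ y < b2 ∧
    k = (a2 - a1) + (b2 - b1)
  have hs := Good.single π (π.symm ⟨y, hy⟩)
  simp only [Equiv.apply_symm_apply] at hs
  have hp : p 2 := ⟨_, _, _, _, hs, by omega, by omega, by omega⟩
  have hbd : ∀ k, p k → k ≤ 2 * n := by
    rintro k ⟨a1, a2, b1, b2, h, _, _, rfl⟩
    obtain ⟨p1, p2, p3, p4, p5, p6⟩ := h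
    omega
  have hspec : p (Nat.findGreatest p (2*n)) := Nat.findGreatest_spec (hbd 2 hp) hp
  have hmax : ∀ k, p k → k ≤ Nat.findGreatest p (2*n) :=
    fun k hk => Nat.le_findGreatest (hbd k hk) hk
  obtain ⟨a1, a2, b1, b2, h, h1, h2, hk⟩ := hspec
  refine ⟨a1, a2, b1, b2, fun _ => ⟨h, h1, h2, ?_⟩⟩
  intro c1 c2 d1 d2 hQ t1 t2 t3 t4
  have := hmax _ ⟨_, _, _, _, h.merge hQ t1 t2 t3 t4, by omega, by omega, rfl⟩
  obtain ⟨p1, p2, p3, p4, p5, p6⟩ := h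
  obtain ⟨q1, q2, q3, q4, q5, q6⟩ := hQ
  omega

theorem sum_conv (m : ℕ) (f : ℕ → ℕ) (j : Fin m) :
    (∑ i ∈ Finset.univ.filter (fun i : Fin m => i < j), f i) = ∑ i ∈ Finset.range j, f i := by
  refine (Finset.sum_map _ Fin.valEmbedding f).symm.trans ?_
  congr 1
  ext x
  simp only [Finset.mem_map, Finset.mem_filter, Finset.mem_univ, true_and, Fin.valEmbedding_apply,
    Finset.mem_range]
  constructor
  · rintro ⟨a, h, rfl⟩; exact h
  · intro h; exact ⟨⟨x, by omega⟩, h, rfl⟩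

theorem stmt_3 (n : ℕ) (hn : 1 ≤ n) (π : Equiv.Perm (Fin n)) :
    ∃ (m : ℕ) (_ : 1 ≤ m) (_ : m ≤ n) (s : Fin m → ℕ) (r : Fin m → ℕ),
      (∀ j, 0 < s j) ∧ (∑ j, s j = n) ∧
      (∀ x : ℕ, x < n → ∃! j : Fin m, r j ≤ x ∧ x < r j + s j) ∧
      percClosure π = {p : Fin n × Fin n | ∃ j : Fin m,
        r j ≤ (p.1 : ℕ) ∧ (p.1 : ℕ) < r j + s j ∧
        (∑ i ∈ Finset.univ.filter (fun i => i < j), s i) ≤ (p.2 : ℕ) ∧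
        (p.2 : ℕ) < (∑ i ∈ Finset.univ.filter (fun i => i < j), s i) + s j} := by
  classical
  choose A1 A2 B1 B2 hG using exists_max π
  -- a good square sharing a column with the maximal square at `y` is contained in it
  have share : ∀ y, y < n → ∀ c1 c2 d1 d2, Good π c1 c2 d1 d2 → ∀ z, z < n →
      B1 y ≤ z → z < B2 y → d1 ≤ z → z < d2 →
      A1 y ≤ c1 ∧ c2 ≤ A2 y ∧ B1 y ≤ d1 ∧ d2 ≤ B2 y := by
    intro y hy c1 c2 d1 d2 hQ z hz h1 h2 h3 h4
    obtain ⟨hP, _, _, hm⟩ := hG y hy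
    have e1 := (hP.2.2.2.2.1 (π.symm ⟨z, hz⟩)).2 (by simpa using ⟨h1, h2⟩)
    have e2 := (hQ.2.2.2.2.1 (π.symm ⟨z, hz⟩)).2 (by simpa using ⟨h3, h4⟩)
    exact hm _ _ _ _ hQ (by omega) (by omega) (by omega) (by omega)
  have same : ∀ y, y < n → ∀ y', y' < n → ∀ z, z < n →
      B1 y ≤ z → z < B2 y → B1 y' ≤ z → z < B2 y' →
      A1 y = A1 y' ∧ A2 y = A2 y' ∧ B1 y = B1 y' ∧ B2 y = B2 y' := by
    intro y hy y' hy' z hz h1 h2 h3 h4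
    have e1 := share y hy _ _ _ _ (hG y' hy').1 z hz h1 h2 h3 h4
    have e2 := share y' hy' _ _ _ _ (hG y hy).1 z hz h3 h4 h1 h2
    omega
  have hU : percClosure π = {p : Fin n × Fin n | A1 p.2 ≤ (p.1:ℕ) ∧ (p.1:ℕ) < A2 p.2} := by
    apply Set.Subset.antisymm
    · apply Set.sInter_subset_of_mem
      constructor
      · rintro ⟨x, y⟩ h
        have h : y = π x := h
        subst h
        obtain ⟨hP, h1, h2, _⟩ := hG (π x) (π x).2
        exact (hP.2.2.2.2.1 x).2 ⟨h1, h2⟩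
      · have mix : ∀ x x' y y' : Fin n, ((x':ℕ) = x + 1 ∨ (x:ℕ) = x' + 1) →
            ((y':ℕ) = y + 1 ∨ (y:ℕ) = y' + 1) → (A1 y ≤ (x':ℕ) ∧ (x':ℕ) < A2 y) →
            (A1 y' ≤ (x:ℕ) ∧ (x:ℕ) < A2 y') → (A1 y ≤ (x:ℕ) ∧ (x:ℕ) < A2 y) := by
          intro x x' y y' h1 h2 h3 h4
          obtain ⟨hP, p1, p2, pm⟩ := hG y y.2
          obtain ⟨hQ, q1, q2, qm⟩ := hG y' y'.2
          have := pm _ _ _ _ hQ (by omega) (by omega) (by omega) (by omega)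
          omega
        rintro ⟨x, y⟩ ⟨⟨dx, dy⟩, hd, ⟨ex, ey⟩, he, hne, hcd, hce⟩
        simp only [Set.mem_setOf_eq] at hd he ⊢
        rcases hcd with ⟨r1, r2⟩ | ⟨r1, r2⟩ <;> rcases hce with ⟨r3, r4⟩ | ⟨r3, r4⟩ <;>
          simp only at r1 r2 r3 r4 <;> subst r1 <;> subst r3
        · have hne' : (dy:ℕ) ≠ ey := fun h => hne (by rw [Fin.ext h])
          obtain ⟨hP, p1, p2, pm⟩ := hG dy dy.2
          obtain ⟨hQ, q1, q2, qm⟩ := hG ey ey.2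
          have e1 := (hP.2.2.2.2.1 x).1 hd
          have e2 := (hQ.2.2.2.2.1 x).1 he
          have e3 := same dy dy.2 ey ey.2 (π x) (π x).2 e1.1 e1.2 e2.1 e2.2
          obtain ⟨hS, s1, s2, sm⟩ := hG y y.2
          have e4 := same dy dy.2 y y.2 y y.2 (by omega) (by omega) s1 s2
          omega
        · exact mix x ex y dy (by omega) (by omega) he hd
        · exact mix x dx y ey (by omega) (by omega) hd he
        · have hne' : (dx:ℕ) ≠ ex := fun h => hne (by rw [Fin.ext h])
          omega
    · rintro ⟨x, y⟩ h
      obtain ⟨hP, h1, h2, _⟩ := hG y y.2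
      obtain ⟨_, _, h⟩ := hP.2.2.2.2.2 x y h.1 h.2 h1 h2
      exact h
  obtain ⟨k, k0, ks⟩ : ∃ k : ℕ → ℕ, k 0 = 0 ∧
      ∀ j, k (j+1) = if k j < n then B2 (k j) else k j :=
    ⟨fun j => Nat.rec 0 (fun _ v => if v < n then B2 v else v) j, rfl, fun j => rfl⟩
  have ks' : ∀ j, k j < n → k (j+1) = B2 (k j) := fun j h => by rw [ks, if_pos h]
  have kle : ∀ j, k j ≤ n := by
    intro j
    induction j with
    | zero => omega
    | succ j ih =>
      rw [ks]; split_ifs with h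
      · exact (hG _ h).1.2.2.2.1
      · exact ih
  have klt : ∀ j, k j < n → k j < k (j+1) := by
    intro j h
    rw [ks' j h]; exact (hG _ h).2.2.1
  have kmono : Monotone k := by
    apply monotone_nat_of_le_succ
    intro j
    by_cases h : k j < n
    · exact (klt j h).le
    · rw [ks, if_neg h]
  have kge : ∀ j, j ≤ k j ∨ n ≤ k j := by
    intro j
    induction j with
    | zero => omega
    | succ j ih =>
      by_cases h : k j < n
      · have := klt j h; omega
      · rw [ks, if_neg h]; omega
  have kB : ∀ j, k j < n → B1 (k j) = k j := by
    intro j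
    cases j with
    | zero => intro h; have := (hG _ h).2.1; omega
    | succ j =>
      intro h
      have hj : k j < n := lt_of_le_of_lt (kmono (Nat.le_succ j)) h
      obtain ⟨hP, p1, p2, pm⟩ := hG _ hj
      obtain ⟨hQ, q1, q2, qm⟩ := hG _ h
      by_contra hne
      have e := ks' j hj
      have := same _ hj _ h (k (j+1) - 1) (by omega) (by omega) (by omega) (by omega) (by omega)
      omega
  have hex : ∃ m, n ≤ k m := ⟨n, by have := kge n; omega⟩
  obtain ⟨m, hm, hmin⟩ : ∃ m, n ≤ k m ∧ ∀ j, j < m → k j < n :=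
    ⟨Nat.find hex, Nat.find_spec hex, fun j hj => by have := Nat.find_min hex hj; omega⟩
  have hkm : k m = n := le_antisymm (kle m) hm
  have hm1 : 1 ≤ m := by
    by_contra h
    have : m = 0 := by omega
    subst this; omega
  have hmn : m ≤ n := by
    have h1 := hmin (m-1) (by omega)
    have h2 := kge (m-1)
    omega
  have hsum : ∀ j, ∑ i ∈ Finset.range j, (k (i+1) - k i) = k j := by
    intro j
    induction j with
    | zero => simp [k0]
    | succ j ih =>
      rw [Finset.sum_range_succ, ih]
      have := kmono (Nat.le_succ j)
      simp only [Nat.succ_eq_add_one] at this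
      omega
  have hA : ∀ j, j < m → A1 (k j) + (k (j+1) - k j) = A2 (k j) := by
    intro j hj
    have h := hmin j hj
    have h1 := (hG _ h).1.size
    have h2 := (hG _ h).1.1
    have h3 := kB j h
    have h4 := ks' j h
    omega
  have loc : ∀ y, y < n → ∃ j, j < m ∧ k j ≤ y ∧ y < k (j+1) := by
    intro y hy
    have hex2 : ∃ j, y < k j := ⟨m, by omega⟩
    have h1 := Nat.find_spec hex2
    have h2 : Nat.find hex2 ≤ m := Nat.find_min' hex2 (by omega)
    have h3 : Nat.find hex2 ≠ 0 := by
      intro h; rw [h] at h1; omega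
    have h4 := Nat.find_min hex2 (m := Nat.find hex2 - 1) (by omega)
    refine ⟨Nat.find hex2 - 1, by omega, by omega, ?_⟩
    rwa [show Nat.find hex2 - 1 + 1 = Nat.find hex2 by omega]
  have uniq : ∀ i j y, k i ≤ y → y < k (i+1) → k j ≤ y → y < k (j+1) → i = j := by
    intro i j y h1 h2 h3 h4
    rcases lt_trichotomy i j with h | h | h
    · have := kmono (show i + 1 ≤ j from h); omega
    · exact h
    · have := kmono (show j + 1 ≤ i from h); omega
  refine ⟨m, hm1, hmn, fun j => k (j+1) - k j, fun j => A1 (k j), ?_, ?_, ?_, ?_⟩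
  · intro j
    have := klt j (hmin j j.2)
    simp only; omega
  · rw [Fin.sum_univ_eq_sum_range (fun i => k (i+1) - k i) m, hsum, hkm]
  · intro x hx
    have key : ∀ j, j < m → ((A1 (k j) ≤ x ∧ x < A1 (k j) + (k (j+1) - k j)) ↔
        (k j ≤ (π ⟨x, hx⟩ : ℕ) ∧ (π ⟨x, hx⟩ : ℕ) < k (j+1))) := by
      intro j hj
      rw [hA j hj]
      have h := hmin j hj
      have := (hG _ h).1.2.2.2.2.1 ⟨x, hx⟩
      rwa [kB j h, ← ks' j h] at this
    obtain ⟨j, hj, hj2⟩ := loc (π ⟨x, hx⟩) (π ⟨x, hx⟩).2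
    refine ⟨⟨j, hj⟩, (key j hj).2 hj2, ?_⟩
    intro i hi
    have := (key i i.2).1 hi
    exact Fin.ext (uniq _ _ _ this.1 this.2 hj2.1 hj2.2)
  · rw [hU]
    ext ⟨x, y⟩
    simp only [Set.mem_setOf_eq]
    have key : ∀ j, j < m → k j ≤ (y:ℕ) → (y:ℕ) < k (j+1) →
        A1 (k j) = A1 y ∧ A2 (k j) = A2 y := by
      intro j hj h1 h2
      have h := hmin j hj
      obtain ⟨hP, p1, p2, pm⟩ := hG y y.2
      have h3 := kB j h
      have h4 := ks' j h
      have := same (k j) h y y.2 y y.2 (by omega) (by omega) p1 p2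
      exact ⟨this.1, this.2.1⟩
    constructor
    · intro hxy
      obtain ⟨j, hj, h1, h2⟩ := loc y y.2
      obtain ⟨e1, e2⟩ := key j hj h1 h2
      refine ⟨⟨j, hj⟩, ?_⟩
      rw [sum_conv m (fun i => k (i+1) - k i), hsum]
      have := hA j hj
      simp only
      omega
    · rintro ⟨j, hj⟩
      rw [sum_conv m (fun i => k (i+1) - k i), hsum] at hj
      have h5 := hA j j.2
      obtain ⟨e1, e2⟩ := key j j.2 (by omega) (by omega)
      omega
end

section
/- Let n ≥ 1 and let π be a permutation of Fin n. Define the reversal π^R ∈ Equiv.Perm (Fin n) by π^R i = π (n − 1 − i). Then π is full if and only if π^R is full. -/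
/-- The reversal `π^R` of `π`, given by `π^R i = π (n − 1 − i)`. -/
def reversal {n : ℕ} (π : Equiv.Perm (Fin n)) : Equiv.Perm (Fin n) :=
  Fin.revPerm.trans π

/-- Reflection of the board in the first coordinate. -/
def flipCell {n : ℕ} (c : Fin n × Fin n) : Fin n × Fin n := (Fin.rev c.1, c.2)

theorem flipCell_flipCell {n : ℕ} (c : Fin n × Fin n) : flipCell (flipCell c) = c := by
  simp [flipCell]

theorem adj_flipCell {n : ℕ} {c d : Fin n × Fin n} (h : Adj c d) :
    Adj (flipCell c) (flipCell d) := by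
  obtain ⟨a, b⟩ := c
  obtain ⟨a', b'⟩ := d
  have h1 := a.isLt
  have h2 := a'.isLt
  simp only [Adj, flipCell, Fin.val_rev, Fin.ext_iff] at h ⊢
  omega

theorem percClosed_flip {n : ℕ} {S : Set (Fin n × Fin n)} (h : PercClosed S) :
    PercClosed (flipCell ⁻¹' S) := by
  rintro c ⟨d, hd, e, he, hne, h1, h2⟩
  refine h _ ⟨flipCell d, hd, flipCell e, he, ?_, adj_flipCell h1, adj_flipCell h2⟩
  intro heq
  apply hne
  rw [← flipCell_flipCell d, heq, flipCell_flipCell]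

theorem full_reversal {n : ℕ} {π : Equiv.Perm (Fin n)} (h : Full π) : Full (reversal π) := by
  refine Set.eq_univ_of_forall fun c => ?_
  rintro S ⟨hg, hS⟩
  have hc : flipCell c ∈ percClosure π := by
    have h' : percClosure π = Set.univ := h
    rw [h']
    trivial
  have := hc (flipCell ⁻¹' S) ⟨?_, percClosed_flip hS⟩
  · rw [Set.mem_preimage, flipCell_flipCell] at this
    exact this
  · intro p hp
    apply hg
    have hp' : p.2 = π p.1 := hp
    simp [graphOf, reversal, flipCell, hp']

theorem reversal_reversal {n : ℕ} (π : Equiv.Perm (Fin n)) : reversal (reversal π) = π := by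
  ext i
  simp [reversal]

theorem stmt_5 (n : ℕ) (hn : 1 ≤ n) (π : Equiv.Perm (Fin n)) :
    Full π ↔ Full (reversal π) := by
  refine ⟨full_reversal, fun h => ?_⟩
  have := full_reversal h
  rwa [reversal_reversal] at this
end

section
/- Let n ≥ 2 and let π be a full permutation of Fin n. Then there exists k with 1 ≤ k < n such that either (a) π maps {0,…,k−1} onto {0,…,k−1}, in which case the prefix permutation σ ∈ Equiv.Perm (Fin k) with σ i = π i and the reduced suffix permutation τ ∈ Equiv.Perm (Fin (n−k)) with τ i = π(k+i) − k are both full; or (b) π maps {0,…,k−1} onto {n−k,…,n−1}, in which case the permutations σ ∈ Equiv.Perm (Fin k) with σ i = π i − (n−k) and τ ∈ Equiv.Perm (Fin (n−k)) with τ i = π(k+i) are both full. -/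
inductive Sp {n : ℕ} (π : Equiv.Perm (Fin n)) : ℕ → ℕ → ℕ → Prop
  | single (i : Fin n) : Sp π i (π i) 1
  | diag (a b m m' : ℕ) : Sp π a b m → Sp π (a + m) (b + m) m' → Sp π a b (m + m')
  | anti (a b m m' : ℕ) : Sp π a (b + m') m → Sp π (a + m) b m' → Sp π a b (m + m')

theorem Sp.basic {n : ℕ} {π : Equiv.Perm (Fin n)} {a b m : ℕ} (h : Sp π a b m) :
    1 ≤ m ∧ a + m ≤ n ∧ b + m ≤ n ∧
    ∀ i : Fin n, (a ≤ (i : ℕ) ∧ (i : ℕ) < a + m) ↔ (b ≤ (π i : ℕ) ∧ (π i : ℕ) < b + m) := by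
  induction h with
  | single i =>
    refine ⟨le_rfl, i.isLt, (π i).isLt, fun k => ?_⟩
    have : (k : ℕ) = i ↔ (π k : ℕ) = π i := by
      rw [← Fin.ext_iff, ← Fin.ext_iff, π.injective.eq_iff]
    omega
  | diag a b m m' _ _ h1 h2 =>
    obtain ⟨p1, p2, p3, p4⟩ := h1
    obtain ⟨q1, q2, q3, q4⟩ := h2
    refine ⟨by omega, by omega, by omega, fun k => ?_⟩
    have := p4 k
    have := q4 k
    omega
  | anti a b m m' _ _ h1 h2 =>
    obtain ⟨p1, p2, p3, p4⟩ := h1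
    obtain ⟨q1, q2, q3, q4⟩ := h2
    refine ⟨by omega, by omega, by omega, fun k => ?_⟩
    have := p4 k
    have := q4 k
    omega

theorem fill_aux (P : ℕ → ℕ → Prop) (M N : ℕ) (h0 : ∀ v, 1 ≤ v → v ≤ N → P 0 v)
    (h1 : ∀ u, 1 ≤ u → u ≤ M → P u 0)
    (hs : ∀ u v, u < M → v < N → P u (v + 1) → P (u + 1) v → P (u + 1) (v + 1)) :
    ∀ u v, u ≤ M → v ≤ N → 1 ≤ u + v → P u v := by
  intro u
  induction u with
  | zero => intro v _ hv h; exact h0 v (by omega) hv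
  | succ u ihu =>
    intro v
    induction v with
    | zero => intro hu _ _; exact h1 _ (by omega) hu
    | succ v ihv =>
      intro hu hv _
      exact hs u v (by omega) (by omega) (ihu _ (by omega) hv (by omega))
        (ihv hu (by omega) (by omega))

theorem Sp.fill {n : ℕ} {π : Equiv.Perm (Fin n)} {a b m : ℕ} (h : Sp π a b m)
    (T : ℕ → ℕ → Prop)
    (H1 : ∀ x y, T x y → T (x + 1) (y + 1) → T (x + 1) y ∧ T x (y + 1))
    (H2 : ∀ x y, T (x + 1) y → T x (y + 1) → T x y ∧ T (x + 1) (y + 1)) :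
    (∀ i : Fin n, a ≤ (i : ℕ) → (i : ℕ) < a + m → T i (π i)) →
    ∀ x y, a ≤ x → x < a + m → b ≤ y → y < b + m → T x y := by
  induction h with
  | single i =>
    intro hT x y h1 h2 h3 h4
    have e1 : x = i := by omega
    have e2 : y = π i := by omega
    rw [e1, e2]
    exact hT i le_rfl (by omega)
  | diag a b m m' s1 s2 ih1 ih2 =>
    intro hT
    have F1 := ih1 (fun i _ _ => hT i (by omega) (by omega))
    have F2 := ih2 (fun i _ _ => hT i (by omega) (by omega))
    have p1 := s1.basic.1
    have p2 := s2.basic.1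
    have SE := fill_aux (fun u v => T (a + m - 1 + u) (b + m - v)) m' m
      (fun v _ _ => F1 _ _ (by omega) (by omega) (by omega) (by omega))
      (fun u _ _ => F2 _ _ (by omega) (by omega) (by omega) (by omega))
      (fun u v hu hv t1 t2 => by
        have := H1 (a + m - 1 + u) (b + m - (v + 1)) t1
          (by rw [show b + m - (v + 1) + 1 = b + m - v by omega]; exact t2)
        exact this.1)
    have NW := fill_aux (fun u v => T (a + m - u) (b + m - 1 + v)) m m'
      (fun v _ _ => F2 _ _ (by omega) (by omega) (by omega) (by omega))
      (fun u _ _ => F1 _ _ (by omega) (by omega) (by omega) (by omega))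
      (fun u v hu hv t1 t2 => by
        have := H1 (a + m - (u + 1)) (b + m - 1 + v) t2
          (by rw [show a + m - (u + 1) + 1 = a + m - u by omega]; exact t1)
        exact this.2)
    intro x y h1 h2 h3 h4
    by_cases hx : x < a + m <;> by_cases hy : y < b + m
    · exact F1 _ _ (by omega) (by omega) (by omega) (by omega)
    · have := NW (a + m - x) (y - (b + m - 1)) (by omega) (by omega) (by omega)
      try dsimp only at this
      rwa [show a + m - (a + m - x) = x by omega,
        show b + m - 1 + (y - (b + m - 1)) = y by omega] at this
    · have := SE (x - (a + m - 1)) (b + m - y) (by omega) (by omega) (by omega)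
      try dsimp only at this
      rwa [show a + m - 1 + (x - (a + m - 1)) = x by omega,
        show b + m - (b + m - y) = y by omega] at this
    · exact F2 _ _ (by omega) (by omega) (by omega) (by omega)
  | anti a b m m' s1 s2 ih1 ih2 =>
    intro hT
    have F1 := ih1 (fun i _ _ => hT i (by omega) (by omega))
    have F2 := ih2 (fun i _ _ => hT i (by omega) (by omega))
    have p1 := s1.basic.1
    have p2 := s2.basic.1
    have NE := fill_aux (fun u v => T (a + m - 1 + u) (b + m' - 1 + v)) m' m
      (fun v _ _ => F1 _ _ (by omega) (by omega) (by omega) (by omega))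
      (fun u _ _ => F2 _ _ (by omega) (by omega) (by omega) (by omega))
      (fun u v hu hv t1 t2 => (H2 _ _ t2 t1).2)
    have SW := fill_aux (fun u v => T (a + m - u) (b + m' - v)) m m'
      (fun v _ _ => F2 _ _ (by omega) (by omega) (by omega) (by omega))
      (fun u _ _ => F1 _ _ (by omega) (by omega) (by omega) (by omega))
      (fun u v hu hv t1 t2 => by
        have := H2 (a + m - (u + 1)) (b + m' - (v + 1))
          (by rw [show a + m - (u + 1) + 1 = a + m - u by omega]; exact t1)
          (by rw [show b + m' - (v + 1) + 1 = b + m' - v by omega]; exact t2)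
        exact this.1)
    intro x y h1 h2 h3 h4
    by_cases hx : x < a + m <;> by_cases hy : y < b + m'
    · have := SW (a + m - x) (b + m' - y) (by omega) (by omega) (by omega)
      try dsimp only at this
      rwa [show a + m - (a + m - x) = x by omega,
        show b + m' - (b + m' - y) = y by omega] at this
    · exact F1 _ _ (by omega) (by omega) (by omega) (by omega)
    · exact F2 _ _ (by omega) (by omega) (by omega) (by omega)
    · have := NE (x - (a + m - 1)) (y - (b + m' - 1)) (by omega) (by omega) (by omega)
      try dsimp only at this
      rwa [show a + m - 1 + (x - (a + m - 1)) = x by omega,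
        show b + m' - 1 + (y - (b + m' - 1)) = y by omega] at this

theorem Sp.full {n : ℕ} {π : Equiv.Perm (Fin n)} {a b m : ℕ} (h : Sp π a b m)
    (σ : Equiv.Perm (Fin m))
    (hσ : ∀ (i : Fin m) (j : Fin n), (j : ℕ) = a + i → (π j : ℕ) = b + σ i) : Full σ := by
  have hb := h.basic
  refine Set.eq_univ_of_forall fun c => ?_
  refine Set.mem_sInter.2 ?_
  rintro S ⟨hg, hc⟩
  have key := h.fill (fun x y => ∃ c ∈ S, x = a + (c.1 : ℕ) ∧ y = b + (c.2 : ℕ)) ?_ ?_ ?_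
    (a + c.1) (b + c.2) (by omega) (by omega) (by omega) (by omega)
  · obtain ⟨d, hd, e1, e2⟩ := key
    have : c = d := Prod.ext (Fin.ext (by omega)) (Fin.ext (by omega))
    rwa [this]
  · rintro x y ⟨⟨c1, c2⟩, hc', e1, e2⟩ ⟨⟨d1, d2⟩, hd, e3, e4⟩
    simp only at e1 e2 e3 e4
    refine ⟨⟨(d1, c2), hc _ ⟨_, hc', _, hd, ?_, ?_, ?_⟩, by simp only; omega, by simp only; omega⟩,
      ⟨(c1, d2), hc _ ⟨_, hc', _, hd, ?_, ?_, ?_⟩, by simp only; omega, by simp only; omega⟩⟩ <;>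
    simp only [Adj, ne_eq, Prod.mk.injEq, Fin.ext_iff, true_and, and_true] <;> omega
  · rintro x y ⟨⟨c1, c2⟩, hc', e1, e2⟩ ⟨⟨d1, d2⟩, hd, e3, e4⟩
    simp only at e1 e2 e3 e4
    refine ⟨⟨(d1, c2), hc _ ⟨_, hc', _, hd, ?_, ?_, ?_⟩, by simp only; omega, by simp only; omega⟩,
      ⟨(c1, d2), hc _ ⟨_, hc', _, hd, ?_, ?_, ?_⟩, by simp only; omega, by simp only; omega⟩⟩ <;>
    simp only [Adj, ne_eq, Prod.mk.injEq, Fin.ext_iff, true_and, and_true] <;> omega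
  · intro i h1 h2
    refine ⟨(⟨i - a, by omega⟩, σ ⟨i - a, by omega⟩), hg rfl, by simp only; omega, ?_⟩
    exact hσ _ _ (by simp only; omega)

theorem Sp.exists_perm {n : ℕ} {π : Equiv.Perm (Fin n)} {a b m : ℕ} (h : Sp π a b m) :
    ∃ σ : Equiv.Perm (Fin m),
      (∀ (i : Fin m) (j : Fin n), (j : ℕ) = a + i → (π j : ℕ) = b + σ i) ∧ Full σ := by
  obtain ⟨h1, h2, h3, h4⟩ := h.basic
  have hr : ∀ i : Fin m, b ≤ (π ⟨a + i, by omega⟩ : ℕ) ∧ (π ⟨a + i, by omega⟩ : ℕ) < b + m :=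
    fun i => (h4 ⟨a + i, by omega⟩).1 (by simp only; omega)
  let f : Fin m → Fin m := fun i => ⟨(π ⟨a + i, by omega⟩ : ℕ) - b, by have := hr i; omega⟩
  have hf : Function.Injective f := by
    intro i j hij
    have e : (π ⟨a + i, by omega⟩ : ℕ) - b = (π ⟨a + j, by omega⟩ : ℕ) - b := Fin.ext_iff.1 hij
    have := hr i
    have := hr j
    have e2 : π ⟨a + i, by omega⟩ = π ⟨a + j, by omega⟩ := Fin.ext (by omega)
    have e3 := Fin.ext_iff.1 (π.injective e2)
    simp only at e3
    exact Fin.ext (by omega)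
  let σ := Equiv.ofBijective f (Finite.injective_iff_bijective.1 hf)
  have hσ : ∀ (i : Fin m) (j : Fin n), (j : ℕ) = a + i → (π j : ℕ) = b + σ i := by
    intro i j hj
    have e : j = ⟨a + i, by omega⟩ := Fin.ext hj
    have e2 : (σ i : ℕ) = (π ⟨a + i, by omega⟩ : ℕ) - b := rfl
    have := hr i
    have e3 := congrArg (fun t => (π t : ℕ)) e
    omega
  exact ⟨σ, hσ, h.full σ hσ⟩

structure Valid {n : ℕ} (π : Equiv.Perm (Fin n)) (A B M : Fin n → ℕ) : Prop where
  sp : ∀ i, Sp π (A i) (B i) (M i)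
  lo : ∀ i : Fin n, A i ≤ (i : ℕ)
  hi : ∀ i : Fin n, (i : ℕ) < A i + M i
  eq : ∀ i j : Fin n, A i ≤ (j : ℕ) → (j : ℕ) < A i + M i → A j = A i ∧ B j = B i ∧ M j = M i

theorem Valid.row {n : ℕ} {π : Equiv.Perm (Fin n)} {A B M : Fin n → ℕ} (h : Valid π A B M)
    (i i' j : Fin n) (h1 : B i ≤ (j : ℕ)) (h2 : (j : ℕ) < B i + M i) (h3 : B i' ≤ (j : ℕ))
    (h4 : (j : ℕ) < B i' + M i') : A i = A i' ∧ B i = B i' ∧ M i = M i' := by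
  obtain ⟨k, rfl⟩ := π.surjective j
  have := ((h.sp i).basic.2.2.2 k).2 ⟨h1, h2⟩
  have := ((h.sp i').basic.2.2.2 k).2 ⟨h3, h4⟩
  have := h.eq i k (by omega) (by omega)
  have := h.eq i' k (by omega) (by omega)
  omega

theorem Valid.merge {n : ℕ} {π : Equiv.Perm (Fin n)} {A B M : Fin n → ℕ} (h : Valid π A B M)
    (i j : Fin n) (b : ℕ) (hA : A j = A i + M i) (hs : Sp π (A i) b (M i + M j)) :
    ∃ A' B' M', Valid π A' B' M' ∧ ∑ k, M k < ∑ k, M' k := by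
  classical
  have pi := (h.sp i).basic.1
  have pj := (h.sp j).basic.1
  have hsep : ∀ k : Fin n, A i ≤ (k : ℕ) → (k : ℕ) < A i + M i + M j →
      (A k = A i ∧ M k = M i) ∨ (A k = A j ∧ M k = M j) := by
    intro k h1 h2
    by_cases hk : (k : ℕ) < A i + M i
    · have := h.eq i k h1 hk; omega
    · have := h.eq j k (by omega) (by omega); omega
  refine ⟨fun k => if A i ≤ (k : ℕ) ∧ (k : ℕ) < A i + M i + M j then A i else A k,
    fun k => if A i ≤ (k : ℕ) ∧ (k : ℕ) < A i + M i + M j then b else B k,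
    fun k => if A i ≤ (k : ℕ) ∧ (k : ℕ) < A i + M i + M j then M i + M j else M k,
    ⟨?_, ?_, ?_, ?_⟩, ?_⟩
  · intro k
    try dsimp only
    split_ifs with hk
    · exact hs
    · exact h.sp k
  · intro k
    have := h.lo k
    try dsimp only
    split_ifs with hk <;> omega
  · intro k
    have := h.hi k
    try dsimp only
    split_ifs with hk <;> omega
  · intro k l
    try dsimp only
    by_cases hk : A i ≤ (k : ℕ) ∧ (k : ℕ) < A i + M i + M j
    · simp only [if_pos hk]
      intro h1 h2
      have hl : A i ≤ (l : ℕ) ∧ (l : ℕ) < A i + M i + M j := by omega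
      simp only [if_pos hl, and_self]
    · simp only [if_neg hk]
      intro h1 h2
      have e := h.eq k l h1 h2
      have hl : ¬ (A i ≤ (l : ℕ) ∧ (l : ℕ) < A i + M i + M j) := by
        intro hl
        have := hsep l hl.1 hl.2
        have := h.lo k
        have := h.hi k
        omega
      simp only [if_neg hl]
      exact e
  · refine Finset.sum_lt_sum ?_ ⟨i, Finset.mem_univ _, ?_⟩
    · intro k _
      try dsimp only
      split_ifs with hk
      · have := hsep k hk.1 hk.2
        omega
      · exact le_rfl
    · have := h.lo i
      have := h.hi i
      rw [if_pos (by omega)]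
      omega

theorem Valid.corner {n : ℕ} {π : Equiv.Perm (Fin n)} {A B M : Fin n → ℕ} (h : Valid π A B M)
    (i j i' j' : Fin n) (hi : (i : ℕ) + 1 = i' ∨ (i' : ℕ) + 1 = i)
    (hj : (j : ℕ) + 1 = j' ∨ (j' : ℕ) + 1 = j)
    (h1 : B i' ≤ (j : ℕ)) (h2 : (j : ℕ) < B i' + M i') (h3 : B i ≤ (j' : ℕ))
    (h4 : (j' : ℕ) < B i + M i) :
    (B i ≤ (j : ℕ) ∧ (j : ℕ) < B i + M i) ∨
    ∃ A' B' M', Valid π A' B' M' ∧ ∑ k, M k < ∑ k, M' k := by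
  by_cases hc : B i ≤ (j : ℕ) ∧ (j : ℕ) < B i + M i
  · exact Or.inl hc
  right
  have li := h.lo i
  have ri := h.hi i
  have li' := h.lo i'
  have ri' := h.hi i'
  have n1 : ¬ (A i ≤ (i' : ℕ) ∧ (i' : ℕ) < A i + M i) := by
    rintro ⟨q1, q2⟩
    have := h.eq i i' q1 q2
    omega
  have n2 : ¬ (A i' ≤ (i : ℕ) ∧ (i : ℕ) < A i' + M i') := by
    rintro ⟨q1, q2⟩
    have := h.eq i' i q1 q2
    omega
  have n3 : ¬ (B i' ≤ (j' : ℕ) ∧ (j' : ℕ) < B i' + M i') := by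
    rintro ⟨q1, q2⟩
    have := h.row i i' j' h3 h4 q1 q2
    omega
  have s := h.sp i
  have s' := h.sp i'
  rcases hi with hi | hi <;> rcases hj with hj | hj
  · have e1 : A i' = A i + M i := by omega
    have e2 : B i = B i' + M i' := by omega
    rw [e2] at s
    rw [e1] at s'
    exact h.merge i i' _ e1 (Sp.anti _ _ _ _ s s')
  · have e1 : A i' = A i + M i := by omega
    have e2 : B i' = B i + M i := by omega
    rw [e1, e2] at s'
    exact h.merge i i' _ e1 (Sp.diag _ _ _ _ s s')
  · have e1 : A i = A i' + M i' := by omega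
    have e2 : B i = B i' + M i' := by omega
    rw [e1, e2] at s
    exact h.merge i' i _ e1 (Sp.diag _ _ _ _ s' s)
  · have e1 : A i = A i' + M i' := by omega
    have e2 : B i' = B i + M i := by omega
    rw [e2] at s'
    rw [e1] at s
    exact h.merge i' i _ e1 (Sp.anti _ _ _ _ s' s)

theorem Valid.closed {n : ℕ} {π : Equiv.Perm (Fin n)} {A B M : Fin n → ℕ} (h : Valid π A B M)
    (hmax : ¬ ∃ A' B' M', Valid π A' B' M' ∧ ∑ k, M k < ∑ k, M' k) :
    PercClosed {c : Fin n × Fin n | B c.1 ≤ (c.2 : ℕ) ∧ (c.2 : ℕ) < B c.1 + M c.1} := by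
  rintro ⟨i, j⟩ ⟨⟨d1, d2⟩, hd, ⟨e1, e2⟩, he, hne, had, hae⟩
  simp only [Set.mem_ofPred_eq, Adj, ne_eq, Prod.mk.injEq] at *
  rcases had with ⟨rfl, had⟩ | ⟨rfl, had⟩ <;> rcases hae with ⟨rfl, hae⟩ | ⟨rfl, hae⟩
  · simp only [Fin.ext_iff, true_and, and_true] at hne
    omega
  · exact (h.corner _ _ _ _ hae had he.1 he.2 hd.1 hd.2).resolve_right hmax
  · exact (h.corner _ _ _ _ had hae hd.1 hd.2 he.1 he.2).resolve_right hmax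
  · have r := h.row d1 e1 j hd.1 hd.2 he.1 he.2
    have := h.lo d1
    have := h.hi d1
    have := h.lo e1
    have := h.hi e1
    simp only [Fin.ext_iff, true_and, and_true] at hne
    have := h.eq d1 i (by omega) (by omega)
    omega

theorem sp_of_full {n : ℕ} (hn : 2 ≤ n) (π : Equiv.Perm (Fin n)) (hfull : Full π) :
    Sp π 0 0 n := by
  by_contra hcon
  have main : ∀ N : ℕ, ∃ A B M, Valid π A B M ∧ N ≤ ∑ k, M k := by
    intro N
    induction N with
    | zero =>
      refine ⟨fun i => i, fun i => π i, fun _ => 1, ⟨fun i => Sp.single i, fun i => le_rfl,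
        fun i => by simp, ?_⟩, Nat.zero_le _⟩
      intro i j h1 h2
      have : j = i := Fin.ext (by omega)
      subst this
      simp
    | succ N ih =>
      obtain ⟨A, B, M, hv, hN⟩ := ih
      by_cases hmax : ∃ A' B' M', Valid π A' B' M' ∧ ∑ k, M k < ∑ k, M' k
      · obtain ⟨A', B', M', hv', hlt⟩ := hmax
        exact ⟨A', B', M', hv', by omega⟩
      · exfalso
        have hcl := hv.closed hmax
        have hall : ∀ c : Fin n × Fin n, B c.1 ≤ (c.2 : ℕ) ∧ (c.2 : ℕ) < B c.1 + M c.1 := by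
          intro c
          have hc : c ∈ percClosure π := by rw [hfull]; trivial
          refine Set.mem_sInter.1 hc _ ⟨?_, hcl⟩
          rintro ⟨i, j⟩ hij
          have hij : j = π i := hij
          subst hij
          exact ((hv.sp i).basic.2.2.2 i).1 ⟨hv.lo i, hv.hi i⟩
        have q0 := hall (⟨0, by omega⟩, ⟨0, by omega⟩)
        have q1 := hall (⟨0, by omega⟩, ⟨n - 1, by omega⟩)
        have s := hv.sp ⟨0, by omega⟩
        have sb := s.basic
        simp only at q0 q1
        have e1 : B ⟨0, by omega⟩ = 0 := by omega
        have e2 : M ⟨0, by omega⟩ = n := by omega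
        have e3 : A ⟨0, by omega⟩ = 0 := by omega
        rw [e1, e2, e3] at s
        exact hcon s
  obtain ⟨A, B, M, hv, hN⟩ := main (n * n + 1)
  have : ∑ k, M k ≤ ∑ _k : Fin n, n :=
    Finset.sum_le_sum fun k _ => by have := (hv.sp k).basic; omega
  simp at this
  omega

theorem Sp.split {n : ℕ} {π : Equiv.Perm (Fin n)} {a b m : ℕ} (h : Sp π a b m) (hm : 2 ≤ m) :
    ∃ k, 1 ≤ k ∧ k < m ∧ ((Sp π a b k ∧ Sp π (a + k) (b + k) (m - k)) ∨
      (Sp π a (b + (m - k)) k ∧ Sp π (a + k) b (m - k))) := by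
  cases h with
  | single i => omega
  | diag _ _ m m' s1 s2 =>
    have := s1.basic.1
    have := s2.basic.1
    refine ⟨m, by omega, by omega, Or.inl ?_⟩
    rw [Nat.add_sub_cancel_left]
    exact ⟨s1, s2⟩
  | anti _ _ m m' s1 s2 =>
    have := s1.basic.1
    have := s2.basic.1
    refine ⟨m, by omega, by omega, Or.inr ?_⟩
    rw [Nat.add_sub_cancel_left]
    exact ⟨s1, s2⟩

theorem stmt_6 (n : ℕ) (hn : 2 ≤ n) (π : Equiv.Perm (Fin n)) (hfull : Full π) :
    ∃ (k : ℕ) (_ : 1 ≤ k) (hk : k < n),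
      (((fun i => π i) '' {i : Fin n | (i : ℕ) < k} = {i : Fin n | (i : ℕ) < k}) ∧
        ∃ (σ : Equiv.Perm (Fin k)) (τ : Equiv.Perm (Fin (n - k))),
          (∀ i : Fin k, (σ i : ℕ) =
            ((π ⟨(i : ℕ), i.isLt.trans hk⟩ : Fin n) : ℕ)) ∧
          (∀ i : Fin (n - k), (τ i : ℕ) =
            ((π ⟨k + (i : ℕ), by have := i.isLt; omega⟩ : Fin n) : ℕ) - k) ∧
          Full σ ∧ Full τ) ∨
      (((fun i => π i) '' {i : Fin n | (i : ℕ) < k} = {i : Fin n | n - k ≤ (i : ℕ)}) ∧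
        ∃ (σ : Equiv.Perm (Fin k)) (τ : Equiv.Perm (Fin (n - k))),
          (∀ i : Fin k, (σ i : ℕ) =
            ((π ⟨(i : ℕ), i.isLt.trans hk⟩ : Fin n) : ℕ) - (n - k)) ∧
          (∀ i : Fin (n - k), (τ i : ℕ) =
            ((π ⟨k + (i : ℕ), by have := i.isLt; omega⟩ : Fin n) : ℕ)) ∧
          Full σ ∧ Full τ) := by
  obtain ⟨k, hk1, hk, h⟩ := (sp_of_full hn π hfull).split hn
  refine ⟨k, hk1, hk, ?_⟩
  rcases h with ⟨s1, s2⟩ | ⟨s1, s2⟩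
  · left
    obtain ⟨σ, hσ, fσ⟩ := s1.exists_perm
    obtain ⟨τ, hτ, fτ⟩ := s2.exists_perm
    refine ⟨?_, σ, τ, ?_, ?_, fσ, fτ⟩
    · ext j
      obtain ⟨i, rfl⟩ := π.surjective j
      have := s1.basic.2.2.2 i
      simp only [Set.mem_image, Set.mem_ofPred_eq, EmbeddingLike.apply_eq_iff_eq, exists_eq_right]
      omega
    · intro i
      have := hσ i ⟨i, i.isLt.trans hk⟩ (by simp)
      omega
    · intro i
      have := hτ i ⟨k + i, by omega⟩ (by simp)
      omega
  · right
    obtain ⟨σ, hσ, fσ⟩ := s1.exists_perm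
    obtain ⟨τ, hτ, fτ⟩ := s2.exists_perm
    refine ⟨?_, σ, τ, ?_, ?_, fσ, fτ⟩
    · ext j
      obtain ⟨i, rfl⟩ := π.surjective j
      have := s1.basic.2.2.2 i
      have := (π i).isLt
      simp only [Set.mem_image, Set.mem_ofPred_eq, EmbeddingLike.apply_eq_iff_eq, exists_eq_right]
      omega
    · intro i
      have := hσ i ⟨i, i.isLt.trans hk⟩ (by simp)
      omega
    · intro i
      have := hτ i ⟨k + i, by omega⟩ (by simp)
      omega
end

section
/- Let n ≥ 2 and let π be a full permutation of Fin n. Then π is indecomposable if and only if there exists k with 1 ≤ k < n such that π maps {0,…,k−1} onto {n−k,…,n−1}. Equivalently, π is decomposable if and only if its top-level bracketing has the form (m₁, m₂), and indecomposable if and only if it has the form [m₁, m₂]. -/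
/-- Columns `[a,a')` are mapped exactly onto rows `[b,b')`. -/
def Blk {n : ℕ} (π : Equiv.Perm (Fin n)) (a a' b b' : ℕ) : Prop :=
  a < a' ∧ a' ≤ n ∧ b < b' ∧ b' ≤ n ∧
    ∀ i : Fin n, (a ≤ (i : ℕ) ∧ (i : ℕ) < a') ↔ (b ≤ (π i : ℕ) ∧ (π i : ℕ) < b')

/-- A sum split or a skew split. -/
def Split {n : ℕ} (π : Equiv.Perm (Fin n)) : Prop :=
  ∃ k, 1 ≤ k ∧ k < n ∧ (Blk π 0 k 0 k ∨ Blk π 0 k (n - k) n)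

theorem fin_card_aux (n a a' : ℕ) (h : a' ≤ n) :
    (Finset.univ.filter (fun i : Fin n => a ≤ (i : ℕ) ∧ (i : ℕ) < a')).card = a' - a := by
  rw [← Nat.card_Ico a a', ← Finset.card_map Fin.valEmbedding]
  congr 1
  ext x
  simp only [Finset.mem_map, Finset.mem_filter, Finset.mem_univ, true_and, Finset.mem_Ico,
    Fin.valEmbedding_apply]
  constructor
  · rintro ⟨i, hi, rfl⟩
    exact hi
  · intro hx
    exact ⟨⟨x, by omega⟩, hx, rfl⟩

theorem Blk.size {n : ℕ} {π : Equiv.Perm (Fin n)} {a a' b b' : ℕ} (h : Blk π a a' b b') :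
    a' - a = b' - b := by
  obtain ⟨_, h2, _, h4, h5⟩ := h
  rw [← fin_card_aux n a a' h2, ← fin_card_aux n b b' h4]
  rw [← Finset.card_map π.toEmbedding]
  congr 1
  ext x
  simp only [Finset.mem_map, Finset.mem_filter, Finset.mem_univ, true_and,
    Equiv.coe_toEmbedding]
  constructor
  · rintro ⟨i, hi, rfl⟩
    exact (h5 i).1 hi
  · intro hx
    exact ⟨π.symm x, (h5 _).2 (by simpa using hx), by simp⟩

theorem Blk.corner {n : ℕ} {π : Equiv.Perm (Fin n)} {a' b b' : ℕ} (h : Blk π 0 a' b b')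
    (ha : a' < n) (hb : b = 0 ∨ b' = n) : Split π := by
  have hs := h.size
  have h1 := h.1
  have h2 := h.2.2.1
  refine ⟨a', by omega, ha, ?_⟩
  rcases hb with rfl | rfl
  · left
    have : b' = a' := by omega
    subst this
    exact h
  · right
    have : b' - a' = b := by have := h.2.2.1; omega
    rw [this]
    exact h

theorem Blk.hull {n : ℕ} {π : Equiv.Perm (Fin n)} {a a' b b' c c' d d' : ℕ}
    (h : Blk π a a' b b') (g : Blk π c c' d d')
    (h1 : a ≤ c') (h2 : c ≤ a') (h3 : b ≤ d') (h4 : d ≤ b') :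
    Blk π (min a c) (max a' c') (min b d) (max b' d') := by
  obtain ⟨p1, p2, p3, p4, p5⟩ := h
  obtain ⟨q1, q2, q3, q4, q5⟩ := g
  refine ⟨by omega, by omega, by omega, by omega, fun i => ?_⟩
  have := p5 i
  have := q5 i
  omega

theorem Blk.full {n : ℕ} {π : Equiv.Perm (Fin n)} {a a' b b' c c' d d' : ℕ}
    (h : Blk π a a' b b') (g : Blk π c c' d d') (hp : a' - a < n) (gp : c' - c < n)
    (h1 : a ≤ c') (h2 : c ≤ a') (h3 : b ≤ d') (h4 : d ≤ b')
    (hf : ¬ (max a' c' - min a c < n)) : Split π := by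
  have s1 := h.size
  have s2 := g.size
  have s3 := (h.hull g h1 h2 h3 h4).size
  have ⟨p1, p2, p3, p4, _⟩ := h
  have ⟨q1, q2, q3, q4, _⟩ := g
  by_cases ha : a = 0
  · subst ha
    exact h.corner (by omega) (by omega)
  · have hc : c = 0 := by omega
    subst hc
    exact g.corner (by omega) (by omega)

set_option maxHeartbeats 2000000 in
theorem split_of_full {n : ℕ} (hn : 2 ≤ n) (π : Equiv.Perm (Fin n)) (hfull : Full π) :
    Split π := by
  by_contra hs
  let S : Set (Fin n × Fin n) := {p | ∃ a a' b b', Blk π a a' b b' ∧ a' - a < n ∧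
    a ≤ (p.1 : ℕ) ∧ (p.1 : ℕ) < a' ∧ b ≤ (p.2 : ℕ) ∧ (p.2 : ℕ) < b'}
  have hG : graphOf π ⊆ S := by
    rintro ⟨x, y⟩ hp
    have hp : y = π x := hp
    subst hp
    refine ⟨x, x + 1, π x, π x + 1, ⟨by omega, by omega, by omega, by omega, fun i => ?_⟩,
      by omega, le_refl _, by simp, le_refl _, by simp⟩
    have e : i = x ↔ π i = π x := π.injective.eq_iff.symm
    rw [Fin.ext_iff, Fin.ext_iff] at e
    omega
  have hC : PercClosed S := by
    rintro ⟨x, y⟩ ⟨⟨x1, y1⟩, ⟨a, a', b, b', h, hp, k1, k2, k3, k4⟩,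
      ⟨x2, y2⟩, ⟨c, c', d, d', g, gp, l1, l2, l3, l4⟩, hne, ad1, ad2⟩
    simp only [Adj, Fin.ext_iff, ne_eq, Prod.mk.injEq] at hne ad1 ad2 k1 k2 k3 k4 l1 l2 l3 l4
    have hx := h.2.2.2.2 x
    have gx := g.2.2.2.2 x
    have hy := h.2.2.2.2 (π.symm y)
    have gy := g.2.2.2.2 (π.symm y)
    rw [Equiv.apply_symm_apply] at hy gy
    have h1 : a ≤ c' := by omega
    have h2 : c ≤ a' := by omega
    have h3 : b ≤ d' := by omega
    have h4 : d ≤ b' := by omega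
    clear hx gx hy gy
    by_cases hf : max a' c' - min a c < n
    · refine ⟨_, _, _, _, h.hull g h1 h2 h3 h4, hf, ?_, ?_, ?_, ?_⟩ <;> dsimp only <;> omega
    · exact absurd (h.full g hp gp h1 h2 h3 h4 hf) hs
  have h0 : ((⟨0, by omega⟩, ⟨0, by omega⟩) : Fin n × Fin n) ∈ S := by
    have : percClosure π ⊆ S := Set.sInter_subset_of_mem ⟨hG, hC⟩
    apply this
    rw [hfull]
    trivial
  obtain ⟨a, a', b, b', h, hp, k1, k2, k3, k4⟩ := h0
  have ha : a = 0 := by simpa using k1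
  have hb : b = 0 := by simpa using k3
  subst ha
  exact hs (h.corner (by omega) (Or.inl hb))

theorem Blk.image {n : ℕ} {π : Equiv.Perm (Fin n)} {k b b' : ℕ} (h : Blk π 0 k b b') :
    (fun i => π i) '' {i : Fin n | (i : ℕ) < k} = {i : Fin n | b ≤ (i : ℕ) ∧ (i : ℕ) < b'} := by
  ext x
  simp only [Set.mem_image, Set.mem_ofPred_eq]
  constructor
  · rintro ⟨i, hi, rfl⟩
    exact (h.2.2.2.2 i).1 ⟨Nat.zero_le _, hi⟩
  · intro hx
    exact ⟨π.symm x, ((h.2.2.2.2 _).2 (by simpa using hx)).2, by simp⟩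

theorem stmt_7 (n : ℕ) (hn : 2 ≤ n) (π : Equiv.Perm (Fin n)) (hfull : Full π) :
    Indecomposable π ↔ ∃ k, 1 ≤ k ∧ k < n ∧
      (fun i => π i) '' {i : Fin n | (i : ℕ) < k} = {i : Fin n | n - k ≤ (i : ℕ)} := by
  constructor
  · intro hi
    obtain ⟨k, h1, h2, h | h⟩ := split_of_full hn π hfull
    · refine absurd ⟨k, h1, h2, ?_⟩ hi
      rw [h.image]
      ext x
      simp
    · refine ⟨k, h1, h2, ?_⟩
      rw [h.image]
      ext x
      simp
  · rintro ⟨k, h1, h2, hk⟩ ⟨j, g1, g2, hj⟩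
    have key : ∀ (m : ℕ) (T : Set (Fin n)),
        (fun i => π i) '' {i : Fin n | (i : ℕ) < m} = T → ∀ i : Fin n, (i : ℕ) < m ↔ π i ∈ T := by
      rintro m T rfl i
      simp
    have a1 := key _ _ hk ⟨0, by omega⟩
    have a2 := key _ _ hk ⟨n - 1, by omega⟩
    have b1 := key _ _ hj ⟨0, by omega⟩
    have b2 := key _ _ hj ⟨n - 1, by omega⟩
    simp only [Set.mem_ofPred_eq] at a1 a2 b1 b2
    omega
end

section
/- Let n ≥ 2 and let π be a permutation of Fin n, with reversal π^R defined by π^R i = π (n − 1 − i). If π is full and indecomposable, then π^R is full and decomposable; if π is full and decomposable, then π^R is full and indecomposable. -/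
theorem full_iff {n : ℕ} (π : Equiv.Perm (Fin n)) :
    Full π ↔ ∀ S, graphOf π ⊆ S → PercClosed S → ∀ c, c ∈ S := by
  unfold Full percClosure
  rw [Set.eq_univ_iff_forall]
  constructor
  · intro h S h1 h2 c
    exact h c S ⟨h1, h2⟩
  · intro h c S hS
    exact h S hS.1 hS.2 c

theorem adj_rev {n : ℕ} (c d : Fin n × Fin n) (h : Adj c d) :
    Adj (Fin.rev c.1, c.2) (Fin.rev d.1, d.2) := by
  obtain ⟨a, b⟩ := c
  obtain ⟨a', b'⟩ := d
  simp only [Adj, Fin.val_rev, Fin.ext_iff] at *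
  omega

theorem full_rev {n : ℕ} (π : Equiv.Perm (Fin n)) (h : Full π) : Full (reversal π) := by
  rw [full_iff] at *
  intro S hS hc c
  have := h {p | (Fin.rev p.1, p.2) ∈ S} ?_ ?_ (Fin.rev c.1, c.2)
  · simpa using this
  · intro p hp
    apply hS
    simp only [graphOf, Set.mem_ofPred_eq] at hp ⊢
    simp [reversal, hp]
  · rintro p ⟨d, hd, e, he, hne, h1, h2⟩
    refine hc _ ⟨_, hd, _, he, ?_, adj_rev _ _ h1, adj_rev _ _ h2⟩
    intro heq
    apply hne
    simp only [Prod.mk.injEq, Fin.rev_inj] at heq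
    exact Prod.ext heq.1 heq.2

theorem not_both {n : ℕ} (hn : 2 ≤ n) (π : Equiv.Perm (Fin n))
    (h1 : ¬ Indecomposable π) (h2 : ¬ Indecomposable (reversal π)) : False := by
  simp only [Indecomposable, not_not] at h1 h2
  obtain ⟨k, hk1, hkn, hk⟩ := h1
  obtain ⟨l, hl1, hln, hl⟩ := h2
  have A : ∀ i : Fin n, (i : ℕ) < k ↔ (π i : ℕ) < k := by
    intro i
    have : π i ∈ (fun i => π i) '' {i : Fin n | (i : ℕ) < k} ↔ (π i : ℕ) < k := by
      rw [hk]; rfl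
    rw [← this]
    simp
  have B : ∀ i : Fin n, (i : ℕ) < l ↔ (reversal π i : ℕ) < l := by
    intro i
    have : reversal π i ∈ (fun i => reversal π i) '' {i : Fin n | (i : ℕ) < l} ↔
        (reversal π i : ℕ) < l := by
      rw [hl]; rfl
    rw [← this]
    simp
  have a1 := A (π.symm ⟨0, by omega⟩)
  have a2 := A (π.symm ⟨n - 1, by omega⟩)
  have b1 := B (Fin.rev (π.symm ⟨0, by omega⟩))
  have b2 := B (Fin.rev (π.symm ⟨n - 1, by omega⟩))
  simp [reversal, Fin.val_rev] at a1 a2 b1 b2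
  omega

theorem decomp_of {n : ℕ} (σ : Equiv.Perm (Fin n)) (k l : ℕ) (hk : 1 ≤ k) (hkn : k < n)
    (hl : l ≤ n) (h : ∀ i : Fin n, (i : ℕ) < k ↔ (σ i : ℕ) < l) : ¬ Indecomposable σ := by
  have e : (fun i => σ i) '' {i : Fin n | (i : ℕ) < k} = {i : Fin n | (i : ℕ) < l} := by
    ext j
    simp only [Set.mem_image, Set.mem_ofPred_eq]
    constructor
    · rintro ⟨i, hi, rfl⟩
      exact (h i).1 hi
    · intro hj
      exact ⟨σ.symm j, (h _).2 (by simpa using hj), by simp⟩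
  have card : ∀ m, m ≤ n → Set.ncard {i : Fin n | (i : ℕ) < m} = m := by
    intro m hm
    have : (fun i : Fin n => (i : ℕ)) '' {i : Fin n | (i : ℕ) < m} = (Finset.range m : Set ℕ) := by
      ext j
      simp only [Set.mem_image, Set.mem_ofPred_eq, Finset.coe_range, Set.mem_Iio]
      constructor
      · rintro ⟨i, hi, rfl⟩
        exact hi
      · intro hj
        exact ⟨⟨j, by omega⟩, hj, rfl⟩
    rw [← Set.ncard_image_of_injective _ Fin.val_injective, this, Set.ncard_coe_finset]
    simp
  have hc := congrArg Set.ncard e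
  rw [Set.ncard_image_of_injective _ σ.injective, card k hkn.le, card l hl] at hc
  subst hc
  exact fun hi => hi ⟨k, hk, hkn, e⟩

theorem decomp_rev_of {n : ℕ} (σ : Equiv.Perm (Fin n)) (k l : ℕ) (hk : 1 ≤ k) (hkn : k < n)
    (hl : l ≤ n) (h : ∀ i : Fin n, k ≤ (i : ℕ) ↔ (σ i : ℕ) < l) :
    ¬ Indecomposable (reversal σ) := by
  apply decomp_of (reversal σ) (n - k) l (by omega) (by omega) hl
  intro i
  have := h (Fin.rev i)
  simp only [reversal, Equiv.trans_apply, Fin.revPerm_apply]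
  rw [← this, Fin.val_rev]
  omega

/-- block congruences -/
def Cong {n : ℕ} (π : Equiv.Perm (Fin n)) (r : Setoid (Fin n)) : Prop :=
  (∀ x y z, x ≤ y → y ≤ z → r x z → r x y) ∧
  (∀ x y z, π x ≤ π y → π y ≤ π z → r x z → r x y)

/-- merging two classes -/
def mrg {α : Type*} (r : Setoid α) (a b : α) : Setoid α where
  r u v := r u v ∨ ((r u a ∨ r u b) ∧ (r v a ∨ r v b))
  iseqv := by
    refine ⟨fun x => Or.inl (r.refl x), ?_, ?_⟩
    · rintro x y (h | h)
      · exact Or.inl (r.symm h)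
      · exact Or.inr ⟨h.2, h.1⟩
    · rintro x y z (h | h) (h' | h')
      · exact Or.inl (r.trans h h')
      · exact Or.inr ⟨h'.1.imp (r.trans h) (r.trans h), h'.2⟩
      · exact Or.inr ⟨h.1, h.2.imp (r.trans (r.symm h')) (r.trans (r.symm h'))⟩
      · exact Or.inr ⟨h.1, h'.2⟩

theorem conv_mrg {n : ℕ} (π : Fin n → Fin n) (r : Setoid (Fin n)) (a b p q : Fin n)
    (hr : ∀ x y z, π x ≤ π y → π y ≤ π z → r x z → r x y)
    (hp : r a p) (hq : r b q)
    (hpq : (π p : ℕ) + 1 = π q ∨ (π q : ℕ) + 1 = π p) :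
    ∀ x y z, π x ≤ π y → π y ≤ π z → mrg r a b x z → mrg r a b x y := by
  have key : ∀ x y z, π x ≤ π y → π y ≤ π z → r x a → r z b → r y a ∨ r y b := by
    intro x y z h1 h2 hx hz
    have hxp : r x p := r.trans hx hp
    have hzq : r z q := r.trans hz hq
    by_cases h : π y ≤ π p
    · left
      exact r.trans (r.symm (hr x y p h1 h hxp)) hx
    · right
      have : π q ≤ π y := by omega
      exact r.trans (r.symm (hr q y z this h2 (r.symm hzq))) (r.symm hq)
  have key' : ∀ x y z, π x ≤ π y → π y ≤ π z → r x b → r z a → r y a ∨ r y b := by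
    intro x y z h1 h2 hx hz
    have hxq : r x q := r.trans hx hq
    have hzp : r z p := r.trans hz hp
    by_cases h : π y ≤ π q
    · right
      exact r.trans (r.symm (hr x y q h1 h hxq)) hx
    · left
      have : π p ≤ π y := by omega
      exact r.trans (r.symm (hr p y z this h2 (r.symm hzp))) (r.symm hp)
  intro x y z h1 h2 h
  rcases h with h | ⟨hx | hx, hz | hz⟩
  · exact Or.inl (hr x y z h1 h2 h)
  · exact Or.inl (hr x y z h1 h2 (r.trans hx (r.symm hz)))
  · exact Or.inr ⟨Or.inl hx, key x y z h1 h2 hx hz⟩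
  · exact Or.inr ⟨Or.inr hx, key' x y z h1 h2 hx hz⟩
  · exact Or.inl (hr x y z h1 h2 (r.trans hx (r.symm hz)))

theorem two_class {n : ℕ} (π : Fin n → Fin n) (r : Setoid (Fin n)) (a b p q : Fin n)
    (hr : ∀ x y z, π x ≤ π y → π y ≤ π z → r x z → r x y)
    (hp : r a p) (hq : r b q) (hab : ¬ r a b) (hall : ∀ u, r u a ∨ r u b)
    (hpq : (π p : ℕ) + 1 = π q) (u : Fin n) : r u a ↔ (π u : ℕ) < π q := by
  constructor
  · intro h
    by_contra hlt
    apply hab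
    have := hr p q u (by omega) (by omega) (r.symm (r.trans h hp))
    exact r.trans hp (r.trans this (r.symm hq))
  · intro h
    rcases hall u with h' | h'
    · exact h'
    · have := hr u p q (by omega) (by omega) (r.trans h' hq)
      exact r.trans this (r.symm hp)

theorem main_dec {n : ℕ} (hn : 2 ≤ n) (π : Equiv.Perm (Fin n)) (hf : Full π) :
    ¬ Indecomposable π ∨ ¬ Indecomposable (reversal π) := by
  have hfin : Finite (Setoid (Fin n)) :=
    Finite.of_injective (fun r : Setoid (Fin n) => (fun x y => r x y : Fin n → Fin n → Prop))
      (fun r s h => Setoid.ext fun a b => iff_of_eq (congrFun (congrFun h a) b))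
  obtain ⟨r, hrm⟩ := (Set.toFinite {r : Setoid (Fin n) | Cong π r ∧ r ≠ ⊤}).exists_maximal
    ⟨⊥, ⟨⟨fun x y z h1 h2 h => by
        have h : x = z := h
        subst h
        exact le_antisymm h1 h2, fun x y z h1 h2 h => by
        have h : x = z := h
        subst h
        exact π.injective (le_antisymm h1 h2)⟩, fun h => by
      have : (⊥ : Setoid (Fin n)) ⟨0, by omega⟩ ⟨1, by omega⟩ := by rw [h]; trivial
      have h' : (⟨0, by omega⟩ : Fin n) = ⟨1, by omega⟩ := this
      simp at h'⟩⟩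
  obtain ⟨⟨⟨hr1, hr2⟩, hrt⟩, hmax⟩ := hrm
  by_contra hcon
  rw [not_or, not_not, not_not] at hcon
  have main : ∀ a b p q : Fin n, r a p → r b q →
      ((a : ℕ) + 1 = b ∨ (b : ℕ) + 1 = a) →
      ((π p : ℕ) + 1 = π q ∨ (π q : ℕ) + 1 = π p) → r a b := by
    intro a b p q hp hq hab hpq
    by_contra hnab
    have hc : Cong π (mrg r a b) :=
      ⟨conv_mrg id r a b a b hr1 (r.refl a) (r.refl b) hab, conv_mrg π r a b p q hr2 hp hq hpq⟩
    have hle : r ≤ mrg r a b := fun _ _ h => Or.inl h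
    have htop : mrg r a b = ⊤ := by
      by_contra hnt
      have : mrg r a b ≤ r := hmax ⟨hc, hnt⟩ hle
      exact hnab (this (Or.inr ⟨Or.inl (r.refl a), Or.inr (r.refl b)⟩))
    have hall : ∀ u, r u a ∨ r u b := by
      intro u
      have : mrg r a b u a := by rw [htop]; trivial
      rcases this with h | h
      · exact Or.inl h
      · exact h.1
    have hall' : ∀ u, r u b ∨ r u a := fun u => (hall u).symm
    have hnba : ¬ r b a := fun h => hnab (r.symm h)
    have hex : ∀ u, r u b ↔ ¬ r u a := by
      intro u
      constructor
      · exact fun h h' => hnab (r.trans (r.symm h') h)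
      · exact fun h => (hall u).resolve_left h
    rcases hab with hab | hab <;> rcases hpq with hpq | hpq
    · have e1 := two_class id r a b a b hr1 (r.refl a) (r.refl b) hnab hall hab
      have e2 := two_class π r a b p q hr2 hp hq hnab hall hpq
      exact decomp_of π b (π q) (by omega) b.2 (π q).2.le
        (fun i => (e1 i).symm.trans (e2 i)) hcon.1
    · have e1 := two_class id r a b a b hr1 (r.refl a) (r.refl b) hnab hall hab
      have e2 := two_class π r b a q p hr2 hq hp hnba hall' hpq
      exact decomp_rev_of π b (π p) (by omega) b.2 (π p).2.le
        (fun i => by rw [← e2 i, hex i, e1 i]; exact not_lt.symm) hcon.2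
    · have e1 := two_class id r b a b a hr1 (r.refl b) (r.refl a) hnba hall' hab
      have e2 := two_class π r a b p q hr2 hp hq hnab hall hpq
      refine decomp_rev_of π a (π q) (by omega) a.2 (π q).2.le (fun i => ?_) hcon.2
      have h1 := e1 i
      rw [hex i, id, id] at h1
      rw [← e2 i, ← not_lt, ← h1, not_not]
    · have e1 := two_class id r b a b a hr1 (r.refl b) (r.refl a) hnba hall' hab
      have e2 := two_class π r b a q p hr2 hq hp hnba hall' hpq
      exact decomp_of π a (π p) (by omega) a.2 (π p).2.le
        (fun i => (e1 i).symm.trans (e2 i)) hcon.1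
  have := (full_iff π).1 hf {c | r c.1 (π.symm c.2)} ?_ ?_
  · apply hrt
    refine Setoid.ext fun u v => ⟨fun _ => trivial, fun _ => ?_⟩
    have := this (u, π v)
    simpa using this
  · intro c hc
    have hc : c.2 = π c.1 := hc
    simp only [Set.mem_ofPred_eq, hc, Equiv.symm_apply_apply]
    exact r.refl _
  · rintro ⟨x, y⟩ ⟨⟨x1, y1⟩, hd, ⟨x2, y2⟩, he, hne, h1, h2⟩
    simp only [Set.mem_ofPred_eq, Adj, ne_eq, Prod.mk.injEq] at *
    have hv : ∀ y1 y2 : Fin n, (y1 : ℕ) + 1 = y → (y : ℕ) + 1 = y2 → r x (π.symm y1) →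
        r x (π.symm y2) → r x (π.symm y) := by
      intro y1 y2 h1 h2 g1 g2
      refine r.trans g1 (hr2 _ _ (π.symm y2) ?_ ?_ (r.trans (r.symm g1) g2)) <;>
        simp only [Equiv.apply_symm_apply] <;> omega
    have hh : ∀ x1 x2 : Fin n, (x1 : ℕ) + 1 = x → (x : ℕ) + 1 = x2 → r x1 (π.symm y) →
        r x2 (π.symm y) → r x (π.symm y) := by
      intro x1 x2 h1 h2 g1 g2
      exact r.trans (r.symm (hr1 x1 x x2 (by omega) (by omega) (r.trans g1 (r.symm g2)))) g1
    have hm : ∀ x1 y2 : Fin n, ((x : ℕ) + 1 = x1 ∨ (x1 : ℕ) + 1 = x) →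
        ((y : ℕ) + 1 = y2 ∨ (y2 : ℕ) + 1 = y) → r x1 (π.symm y) → r x (π.symm y2) →
        r x (π.symm y) := by
      intro x1 y2 h1 h2 g1 g2
      refine r.trans (main x x1 (π.symm y2) (π.symm y) g2 g1 h1 ?_) g1
      simp only [Equiv.apply_symm_apply]
      omega
    rcases h1 with ⟨rfl, h1⟩ | ⟨rfl, h1⟩ <;> rcases h2 with ⟨rfl, h2⟩ | ⟨rfl, h2⟩
    · rcases h1 with h1 | h1 <;> rcases h2 with h2 | h2
      · exact absurd ⟨rfl, Fin.ext (by omega)⟩ hne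
      · exact hv _ _ h2 h1 he hd
      · exact hv _ _ h1 h2 hd he
      · exact absurd ⟨rfl, Fin.ext (by omega)⟩ hne
    · exact hm _ _ h2 h1 he hd
    · exact hm _ _ h1 h2 hd he
    · rcases h1 with h1 | h1 <;> rcases h2 with h2 | h2
      · exact absurd ⟨Fin.ext (by omega), rfl⟩ hne
      · exact hh _ _ h2 h1 he hd
      · exact hh _ _ h1 h2 hd he
      · exact absurd ⟨Fin.ext (by omega), rfl⟩ hne

theorem stmt_8 (n : ℕ) (hn : 2 ≤ n) (π : Equiv.Perm (Fin n)) :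
    (Full π ∧ Indecomposable π →
      Full (reversal π) ∧ ¬ Indecomposable (reversal π)) ∧
    (Full π ∧ ¬ Indecomposable π →
      Full (reversal π) ∧ Indecomposable (reversal π)) := by 
  refine ⟨fun h => ⟨full_rev π h.1, ?_⟩, fun h => ⟨full_rev π h.1, ?_⟩⟩
  · exact (main_dec hn π h.1).resolve_left (fun h' => h' h.2)
  · by_contra h'
    exact not_both hn π h.2 h'
end

section
/- Let n ≥ 1 and let π be a permutation of Fin n. For 0 ≤ v < n, say the suffix of π at v is indecomposable if the reduced suffix permutation τ_v ∈ Equiv.Perm (Fin (n−v)) — defined by letting τ_v i be the number of indices j with v ≤ j < n and π j < π (v+i) (the rank of π(v+i) among the suffix values) — is indecomposable. Let v be the least index such that the suffix of π at v is indecomposable (such v exists since the suffix at n−1 is indecomposable). Then π maps {0,…,v−1} onto itself; that is, the maximum-length indecomposable suffix of π is exactly the rightmost indecomposable component of π. -/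
/-- The suffix of `π` at position `v` is indecomposable: the reduced suffix permutation
`τ_v`, sending `i` to the rank of `π (v + i)` among the suffix values, is indecomposable. -/
def SuffixIndec (n : ℕ) (π : Equiv.Perm (Fin n)) (v : ℕ) (hv : v < n) : Prop :=
  ∃ τ : Equiv.Perm (Fin (n - v)),
    (∀ i : Fin (n - v),
      (τ i : ℕ) = (Finset.univ.filter (fun j : Fin n =>
        v ≤ (j : ℕ) ∧ (π j : ℕ) <
          ((π ⟨v + (i : ℕ), by have := i.isLt; omega⟩ : Fin n) : ℕ))).card) ∧
    Indecomposable τ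

theorem image_eq_aux {m : ℕ} (σ : Equiv.Perm (Fin m)) (k : ℕ)
    (h : ∀ i : Fin m, (i : ℕ) < k → (σ i : ℕ) < k) :
    (fun i => σ i) '' {i : Fin m | (i : ℕ) < k} = {i : Fin m | (i : ℕ) < k} := by
  apply Set.eq_of_subset_of_ncard_le
  · rintro _ ⟨i, hi, rfl⟩
    exact h i hi
  · rw [Set.ncard_image_of_injective _ σ.injective]
  · exact Set.toFinite _

/-- All values at positions in `[w, k)` are below those at positions `≥ k`. -/
def SplitAt {n : ℕ} (π : Equiv.Perm (Fin n)) (w k : ℕ) : Prop :=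
  ∀ a b : Fin n, w ≤ (a : ℕ) → (a : ℕ) < k → k ≤ (b : ℕ) → (π a : ℕ) < (π b : ℕ)

/-- rank -/
def rk {n : ℕ} (π : Equiv.Perm (Fin n)) (v : ℕ) (a : Fin n) : ℕ :=
  (Finset.univ.filter (fun j : Fin n => v ≤ (j : ℕ) ∧ (π j : ℕ) < (π a : ℕ))).card

theorem rk_mono {n : ℕ} (π : Equiv.Perm (Fin n)) (v : ℕ) (a b : Fin n)
    (h : (π a : ℕ) ≤ (π b : ℕ)) : rk π v a ≤ rk π v b := by
  apply Finset.card_le_card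
  intro j
  simp only [Finset.mem_filter, Finset.mem_univ, true_and]
  omega

theorem rk_strict {n : ℕ} (π : Equiv.Perm (Fin n)) (v : ℕ) (a b : Fin n) (ha : v ≤ (a : ℕ))
    (h : (π a : ℕ) < (π b : ℕ)) : rk π v a < rk π v b := by
  apply Finset.card_lt_card
  rw [Finset.ssubset_iff_of_subset]
  · refine ⟨a, ?_, ?_⟩
    · simp [ha]; exact h
    · simp
  · intro j
    simp only [Finset.mem_filter, Finset.mem_univ, true_and]
    omega

theorem rk_lt {n : ℕ} (π : Equiv.Perm (Fin n)) (v k : ℕ) (a : Fin n) (ha : v ≤ (a : ℕ))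
    (hak : (a : ℕ) < k) (h : k < n → SplitAt π v k) : rk π v a < k - v := by
  have h1 : (Finset.univ.filter
      (fun j : Fin n => v ≤ (j : ℕ) ∧ (π j : ℕ) < (π a : ℕ))).map Fin.valEmbedding
      ⊂ Finset.Ico v k := by
    rw [Finset.ssubset_iff_of_subset]
    · refine ⟨a, by simp [ha, hak], ?_⟩
      simp only [Finset.mem_map, Finset.mem_filter, Finset.mem_univ, true_and,
        Fin.valEmbedding_apply, not_exists, not_and]
      rintro j ⟨_, h3⟩ h4
      rw [Fin.ext h4] at h3
      omega
    · intro x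
      simp only [Finset.mem_map, Finset.mem_filter, Finset.mem_univ, true_and,
        Fin.valEmbedding_apply, Finset.mem_Ico]
      rintro ⟨j, ⟨h3, h4⟩, rfl⟩
      refine ⟨h3, ?_⟩
      by_contra h5
      have := h (by omega) a j ha hak (by omega)
      omega
  have := Finset.card_lt_card h1
  simpa [rk] using this

theorem not_split {n : ℕ} (π : Equiv.Perm (Fin n)) (v : ℕ) (hv : v < n)
    (h : SuffixIndec n π v hv) (k : ℕ) (hk : v < k) (hkn : k < n) : ¬ SplitAt π v k := by
  intro hs
  obtain ⟨τ, h1, h2⟩ := h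
  refine h2 ⟨k - v, by omega, by omega, image_eq_aux τ _ ?_⟩
  intro i hi
  rw [h1 i]
  exact rk_lt π v k ⟨v + i, by omega⟩ (by simp) (by simp; omega) (fun _ => hs)

theorem exists_split {n : ℕ} (π : Equiv.Perm (Fin n)) (v : ℕ) (hv : v < n)
    (h : ¬ SuffixIndec n π v hv) : ∃ k, v < k ∧ k < n ∧ SplitAt π v k := by
  let f : Fin (n - v) → Fin (n - v) := fun i =>
    ⟨rk π v ⟨v + i, by omega⟩,
      rk_lt π v n ⟨v + i, by omega⟩ (by simp) (by simp; omega) (fun h => absurd h (by omega))⟩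
  have hf : Function.Injective f := by
    intro i j hij
    have hij' : rk π v ⟨v + i, by omega⟩ = rk π v ⟨v + j, by omega⟩ := congrArg Fin.val hij
    have h1 : (π ⟨v + i, by omega⟩ : ℕ) = (π ⟨v + j, by omega⟩ : ℕ) := by
      rcases lt_trichotomy (π ⟨v + i, by omega⟩ : ℕ) (π ⟨v + j, by omega⟩ : ℕ) with h | h | h
      · have := rk_strict π v _ _ (by simp) h
        omega
      · exact h
      · have := rk_strict π v _ _ (by simp) h
        omega
    have h2 := π.injective (Fin.ext h1)
    simp only [Fin.mk.injEq] at h2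
    exact Fin.ext (by omega)
  let τ : Equiv.Perm (Fin (n - v)) := Equiv.ofBijective f (Finite.injective_iff_bijective.mp hf)
  have h3 : ¬ Indecomposable τ := fun hi => h ⟨τ, fun i => rfl, hi⟩
  unfold Indecomposable at h3
  rw [not_not] at h3
  obtain ⟨k, hk1, hk2, him⟩ := h3
  refine ⟨v + k, by omega, by omega, ?_⟩
  intro a b ha hak hb
  by_contra hlt
  have h4 := rk_mono π v b a (by omega)
  have h5 : τ ⟨a - v, by omega⟩ ∈ {i : Fin (n - v) | (i : ℕ) < k} := by
    rw [← him]
    exact ⟨_, by simp; omega, rfl⟩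
  have h6 : τ ⟨b - v, by omega⟩ ∉ {i : Fin (n - v) | (i : ℕ) < k} := by
    rw [← him]
    rintro ⟨i, hi, hie⟩
    have := τ.injective hie
    subst this
    simp at hi
    omega
  have e1 : (τ ⟨a - v, by omega⟩ : ℕ) = rk π v a := by
    change rk π v ⟨v + (a - v), _⟩ = _
    congr 1
    exact Fin.ext (by simp; omega)
  have e2 : (τ ⟨b - v, by omega⟩ : ℕ) = rk π v b := by
    change rk π v ⟨v + (b - v), _⟩ = _
    congr 1
    exact Fin.ext (by simp; omega)
  simp only [Set.mem_setOf_eq, e1, e2] at h5 h6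
  omega

theorem stmt_10 (n : ℕ) (hn : 1 ≤ n) (π : Equiv.Perm (Fin n))
    (v : ℕ) (hv : v < n)
    (h1 : SuffixIndec n π v hv)
    (h2 : ∀ w (hw : w < v), ¬ SuffixIndec n π w (hw.trans hv)) :
    (fun i => π i) '' {i : Fin n | (i : ℕ) < v} = {i : Fin n | (i : ℕ) < v} := by
  have key : ∀ d w, v - w = d → w < v → SplitAt π w v := by
    intro d
    induction d using Nat.strong_induction_on with
    | _ d ih =>
      intro w hd hw
      obtain ⟨k, hk1, hk2, hs⟩ := exists_split π w (hw.trans hv) (h2 w hw)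
      have hkv : k ≤ v := by
        by_contra hc
        exact not_split π v hv h1 k (by omega) hk2
          (fun a b ha hak hb => hs a b (by omega) hak hb)
      rcases hkv.eq_or_lt with rfl | hlt
      · exact hs
      · have h3 := ih (v - k) (by omega) k rfl hlt
        intro a b ha hav hb
        by_cases hak : (a : ℕ) < k
        · exact hs a b ha hak (by omega)
        · exact h3 a b (by omega) hav hb
  apply image_eq_aux
  intro a ha
  have hs := key v 0 (by omega) (by omega)
  have h3 : rk π 0 a < v - 0 := rk_lt π 0 v a (by omega) ha (fun _ => hs)
  have h4 : rk π 0 a = (π a : ℕ) := by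
    have : (Finset.univ.filter
      (fun j : Fin n => 0 ≤ (j : ℕ) ∧ (π j : ℕ) < (π a : ℕ))).map π.toEmbedding
        = Finset.Iio (π a) := by
      ext x
      simp only [Finset.mem_map_equiv, Finset.mem_filter, Finset.mem_univ, true_and,
        Finset.mem_Iio, Equiv.apply_symm_apply, Fin.lt_def, Nat.zero_le]
    have := congrArg Finset.card this
    simpa [rk] using this
  omega
end

section
/- Let n ≥ 2, let π be a permutation of Fin n, and suppose π maps {0,…,k−1} onto itself for some k with 1 ≤ k < n. Let σ ∈ Equiv.Perm (Fin k) be the prefix permutation σ i = π i, and let τ ∈ Equiv.Perm (Fin (n−k)) be the reduced suffix permutation τ i = π(k+i) − k. Then π is full if and only if both σ and τ are full. Consequently, a permutation is full if and only if each of its indecomposable components is full. -/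
/-- Blocks obtained by successive corner merging. -/
inductive SepB (n : ℕ) (p : ℕ → ℕ) : ℕ → ℕ → ℕ → Prop
  | base (i : ℕ) (h : i < n) : SepB n p i (p i) 1
  | diag (x y a b : ℕ) : SepB n p x y a → SepB n p (x + a) (y + a) b → SepB n p x y (a + b)
  | anti (x y a b : ℕ) : SepB n p x (y + b) a → SepB n p (x + a) y b → SepB n p x y (a + b)

theorem SepB.cast {n : ℕ} {p : ℕ → ℕ} {x y l x' y' l' : ℕ} (h : SepB n p x y l)
    (hx : x = x') (hy : y = y') (hl : l = l') : SepB n p x' y' l' := by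
  subst hx hy hl; exact h

theorem SepB.pos {n : ℕ} {p : ℕ → ℕ} {x y l : ℕ} (h : SepB n p x y l) :
    1 ≤ l ∧ x + l ≤ n := by
  induction h <;> omega

theorem SepB.maps {n : ℕ} {p : ℕ → ℕ} {x y l : ℕ} (h : SepB n p x y l) :
    ∀ i, x ≤ i → i < x + l → y ≤ p i ∧ p i < y + l := by
  induction h with
  | base i h => intro j h1 h2; obtain rfl : j = i := by omega
                omega
  | diag x y a b h1 h2 ih1 ih2 =>
    intro i hi1 hi2
    by_cases hc : i < x + a
    · have := ih1 i hi1 hc; omega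
    · have := ih2 i (by omega) (by omega); omega
  | anti x y a b h1 h2 ih1 ih2 =>
    intro i hi1 hi2
    by_cases hc : i < x + a
    · have := ih1 i hi1 hc; omega
    · have := ih2 i (by omega) (by omega); omega

theorem SepB.surj {n : ℕ} {p : ℕ → ℕ} {x y l : ℕ} (h : SepB n p x y l) :
    ∀ j, y ≤ j → j < y + l → ∃ i, x ≤ i ∧ i < x + l ∧ p i = j := by
  induction h with
  | base i h => intro j h1 h2; exact ⟨i, by omega, by omega, by omega⟩
  | diag x y a b h1 h2 ih1 ih2 =>
    intro i hi1 hi2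
    by_cases hc : i < y + a
    · obtain ⟨j, _, _, _⟩ := ih1 i hi1 hc; exact ⟨j, by omega, by omega, by omega⟩
    · obtain ⟨j, _, _, _⟩ := ih2 i (by omega) (by omega); exact ⟨j, by omega, by omega, by omega⟩
  | anti x y a b h1 h2 ih1 ih2 =>
    intro i hi1 hi2
    by_cases hc : i < y + b
    · obtain ⟨j, _, _, _⟩ := ih2 i hi1 hc; exact ⟨j, by omega, by omega, by omega⟩
    · obtain ⟨j, _, _, _⟩ := ih1 i (by omega) (by omega); exact ⟨j, by omega, by omega, by omega⟩

theorem SepB.fill {n : ℕ} {p : ℕ → ℕ} {x y l : ℕ} (h : SepB n p x y l) (P : ℕ → ℕ → Prop)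
    (hb : ∀ i, i < n → P i (p i))
    (d1 : ∀ u v, P u v → P (u+1) (v+1) → P u (v+1) ∧ P (u+1) v)
    (d2 : ∀ u v, P u (v+1) → P (u+1) v → P u v ∧ P (u+1) (v+1)) :
    ∀ u v, x ≤ u → u < x + l → y ≤ v → v < y + l → P u v := by
  induction h with
  | base i h =>
    intro u v _ _ _ _
    obtain rfl : u = i := by omega
    obtain rfl : v = p u := by omega
    exact hb u h
  | diag x y a b h1 h2 ih1 ih2 =>
    have p1 := h1.pos
    have p2 := h2.pos
    have key : ∀ s i j, i + j = s → i < a → j < b →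
        P (x + a - 1 - i) (y + a + j) := by
      intro s
      induction s with
      | zero =>
        intro i j hs hi hj
        obtain rfl : i = 0 := by omega
        obtain rfl : j = 0 := by omega
        have := (d1 (x + a - 1) (y + a - 1) (ih1 _ _ (by omega) (by omega) (by omega) (by omega))
          (ih2 _ _ (by omega) (by omega) (by omega) (by omega))).1
        convert this using 1 <;> omega
      | succ s ihs =>
        intro i j hs hi hj
        have A : P (x + a - 1 - i) (y + a + j - 1) := by
          by_cases hj0 : j = 0
          · exact ih1 _ _ (by omega) (by omega) (by omega) (by omega)
          · have := ihs i (j-1) (by omega) (by omega) (by omega)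
            convert this using 1 <;> omega
        have B : P (x + a - i) (y + a + j) := by
          by_cases hi0 : i = 0
          · exact ih2 _ _ (by omega) (by omega) (by omega) (by omega)
          · have := ihs (i-1) j (by omega) (by omega) (by omega)
            convert this using 1 <;> omega
        have := (d1 (x + a - 1 - i) (y + a + j - 1) A (by convert B using 1 <;> omega)).1
        convert this using 1 <;> omega
    have key2 : ∀ s i j, i + j = s → i < b → j < a →
        P (x + a + i) (y + a - 1 - j) := by
      intro s
      induction s with
      | zero =>
        intro i j hs hi hj
        obtain rfl : i = 0 := by omega
        obtain rfl : j = 0 := by omega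
        have := (d1 (x + a - 1) (y + a - 1) (ih1 _ _ (by omega) (by omega) (by omega) (by omega))
          (ih2 _ _ (by omega) (by omega) (by omega) (by omega))).2
        convert this using 1 <;> omega
      | succ s ihs =>
        intro i j hs hi hj
        have A : P (x + a + i - 1) (y + a - 1 - j) := by
          by_cases hj0 : i = 0
          · exact ih1 _ _ (by omega) (by omega) (by omega) (by omega)
          · have := ihs (i-1) j (by omega) (by omega) (by omega)
            convert this using 1 <;> omega
        have B : P (x + a + i) (y + a - j) := by
          by_cases hi0 : j = 0
          · exact ih2 _ _ (by omega) (by omega) (by omega) (by omega)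
          · have := ihs i (j-1) (by omega) (by omega) (by omega)
            convert this using 1 <;> omega
        have := (d1 (x + a + i - 1) (y + a - 1 - j) A (by convert B using 1 <;> omega)).2
        convert this using 1 <;> omega
    intro u v hu1 hu2 hv1 hv2
    by_cases hu : u < x + a <;> by_cases hv : v < y + a
    · exact ih1 _ _ (by omega) (by omega) (by omega) (by omega)
    · have := key _ (x + a - 1 - u) (v - (y + a)) rfl (by omega) (by omega)
      convert this using 1 <;> omega
    · have := key2 _ (u - (x + a)) (y + a - 1 - v) rfl (by omega) (by omega)
      convert this using 1 <;> omega
    · exact ih2 _ _ (by omega) (by omega) (by omega) (by omega)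
  | anti x y a b h1 h2 ih1 ih2 =>
    have p1 := h1.pos
    have p2 := h2.pos
    have key : ∀ s i j, i + j = s → i < a → j < b →
        P (x + a - 1 - i) (y + b - 1 - j) := by
      intro s
      induction s using Nat.strong_induction_on with
      | _ s ihs =>
        intro i j hs hi hj
        have A : P (x + a - 1 - i) (y + b - j) := by
          by_cases hj0 : j = 0
          · exact ih1 _ _ (by omega) (by omega) (by omega) (by omega)
          · have := ihs (s-1) (by omega) i (j-1) (by omega) (by omega) (by omega)
            convert this using 1 <;> omega
        have B : P (x + a - i) (y + b - 1 - j) := by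
          by_cases hi0 : i = 0
          · exact ih2 _ _ (by omega) (by omega) (by omega) (by omega)
          · have := ihs (s-1) (by omega) (i-1) j (by omega) (by omega) (by omega)
            convert this using 1 <;> omega
        exact (d2 (x + a - 1 - i) (y + b - 1 - j) (by convert A using 1 ; omega)
          (by convert B using 1 ; omega)).1
    have key2 : ∀ s i j, i + j = s → i < b → j < a →
        P (x + a + i) (y + b + j) := by
      intro s
      induction s using Nat.strong_induction_on with
      | _ s ihs =>
        intro i j hs hi hj
        have A : P (x + a + i - 1) (y + b + j) := by
          by_cases hj0 : i = 0
          · exact ih1 _ _ (by omega) (by omega) (by omega) (by omega)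
          · have := ihs (s-1) (by omega) (i-1) j (by omega) (by omega) (by omega)
            convert this using 1 <;> omega
        have B : P (x + a + i) (y + b + j - 1) := by
          by_cases hi0 : j = 0
          · exact ih2 _ _ (by omega) (by omega) (by omega) (by omega)
          · have := ihs (s-1) (by omega) i (j-1) (by omega) (by omega) (by omega)
            convert this using 1 <;> omega
        have := (d2 (x + a + i - 1) (y + b + j - 1) (by convert A using 1 ; omega)
          (by convert B using 1 ; omega)).2
        convert this using 1 <;> omega
    intro u v hu1 hu2 hv1 hv2
    by_cases hu : u < x + a <;> by_cases hv : v < y + b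
    · have := key _ (x + a - 1 - u) (y + b - 1 - v) rfl (by omega) (by omega)
      convert this using 1 <;> omega
    · exact ih1 _ _ (by omega) (by omega) (by omega) (by omega)
    · exact ih2 _ _ (by omega) (by omega) (by omega) (by omega)
    · have := key2 _ (u - (x + a)) (v - (y + b)) rfl (by omega) (by omega)
      convert this using 1 <;> omega

/-- A partition of the rows into blocks. -/
structure BlkV (n : ℕ) (p : ℕ → ℕ) (X Y L : ℕ → ℕ) : Prop where
  sep : ∀ i, i < n → SepB n p (X i) (Y i) (L i)
  mem : ∀ i, i < n → X i ≤ i ∧ i < X i + L i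
  con : ∀ i, i < n → ∀ j, X i ≤ j → j < X i + L i → X j = X i ∧ Y j = Y i ∧ L j = L i

theorem BlkV.merge {n : ℕ} {p X Y L : ℕ → ℕ} (h : BlkV n p X Y L) (d e : ℕ)
    (hd : d < n) (he : e < n) (hX : X e = X d + L d) (y : ℕ)
    (hs : SepB n p (X d) y (L d + L e)) :
    ∃ X' Y' L' : ℕ → ℕ, BlkV n p X' Y' L' ∧
      ∑ i ∈ Finset.range n, L i < ∑ i ∈ Finset.range n, L' i := by
  have pd := (h.sep d hd).pos
  have pe := (h.sep e he).pos
  have cls : ∀ i, X d ≤ i → i < X d + (L d + L e) →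
      (X i = X d ∧ L i = L d) ∨ (X i = X e ∧ L i = L e) := by
    intro i h1 h2
    by_cases hc : i < X d + L d
    · have := h.con d hd i h1 hc; omega
    · have := h.con e he i (by omega) (by omega); omega
  refine ⟨fun i => if X d ≤ i ∧ i < X d + (L d + L e) then X d else X i,
    fun i => if X d ≤ i ∧ i < X d + (L d + L e) then y else Y i,
    fun i => if X d ≤ i ∧ i < X d + (L d + L e) then L d + L e else L i, ⟨?_, ?_, ?_⟩, ?_⟩
  · intro i hi
    by_cases hc : X d ≤ i ∧ i < X d + (L d + L e)
    · simpa only [if_pos hc] using hs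
    · simpa only [if_neg hc] using h.sep i hi
  · intro i hi
    by_cases hc : X d ≤ i ∧ i < X d + (L d + L e)
    · simpa only [if_pos hc] using hc
    · simpa only [if_neg hc] using h.mem i hi
  · intro i hi j
    by_cases hc : X d ≤ i ∧ i < X d + (L d + L e)
    · simp only [if_pos hc]
      intro h1 h2
      simp only [if_pos (And.intro h1 h2), and_self]
    · simp only [if_neg hc]
      intro h1 h2
      have hj : ¬ (X d ≤ j ∧ j < X d + (L d + L e)) := by
        intro hj
        have c1 := h.con i hi j h1 h2
        have c2 := cls j hj.1 hj.2
        have := h.mem i hi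
        omega
      simp only [if_neg hj]
      exact h.con i hi j h1 h2
  · apply Finset.sum_lt_sum
    · intro i hi
      split_ifs with hc
      · have := cls i hc.1 hc.2; omega
      · exact le_rfl
    · refine ⟨d, Finset.mem_range.2 hd, ?_⟩
      have := h.mem d hd
      have hc : X d ≤ d ∧ d < X d + (L d + L e) := by omega
      simp only [if_pos hc]; omega

theorem BlkV.merge2 {n : ℕ} {p X Y L : ℕ → ℕ} (h : BlkV n p X Y L)
    (d e v w : ℕ) (hd : d < n) (he : e < n) (hde : d + 1 = e) (hne : X d ≠ X e)
    (hv : Y d ≤ v ∧ v < Y d + L d) (hw : Y e ≤ w ∧ w < Y e + L e)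
    (hvw : v + 1 = w ∨ w + 1 = v)
    (hdis : ∀ j, Y d ≤ j → j < Y d + L d → Y e ≤ j → j < Y e + L e → False) :
    ∃ X' Y' L' : ℕ → ℕ, BlkV n p X' Y' L' ∧
      ∑ i ∈ Finset.range n, L i < ∑ i ∈ Finset.range n, L' i := by
  have md := h.mem d hd
  have me := h.mem e he
  have hX : X e = X d + L d := by
    have a1 : ¬ e < X d + L d := by
      intro hc; have := h.con d hd e (by omega) hc; omega
    have a2 : ¬ X e ≤ d := by
      intro hc; have := h.con e he d hc (by omega); omega
    omega
  have sd := h.sep d hd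
  have se := h.sep e he
  rcases hvw with hvw | hvw
  · have hY : Y e = Y d + L d := by
      have a1 : ¬ w < Y d + L d := fun hc => hdis w (by omega) hc hw.1 hw.2
      have a2 : ¬ Y e ≤ v := fun hc => hdis v hv.1 hv.2 hc (by omega)
      omega
    exact h.merge d e hd he hX (Y d) (SepB.diag _ _ _ _ sd (se.cast hX hY rfl))
  · have hY : Y d = Y e + L e := by
      have a1 : ¬ v < Y e + L e := fun hc => hdis v hv.1 hv.2 (by omega) hc
      have a2 : ¬ Y d ≤ w := fun hc => hdis w hc (by omega) hw.1 hw.2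
      omega
    exact h.merge d e hd he hX (Y e) (SepB.anti _ _ _ _ (sd.cast rfl hY rfl) (se.cast hX rfl rfl))

theorem exists_maxBlk (n : ℕ) (p : ℕ → ℕ) : ∃ X Y L : ℕ → ℕ, BlkV n p X Y L ∧
    ∀ X' Y' L' : ℕ → ℕ, BlkV n p X' Y' L' →
      ¬ ∑ i ∈ Finset.range n, L i < ∑ i ∈ Finset.range n, L' i := by
  have key : ∀ m, ∀ X Y L : ℕ → ℕ, BlkV n p X Y L → n * n - ∑ i ∈ Finset.range n, L i ≤ m →
      ∃ X Y L : ℕ → ℕ, BlkV n p X Y L ∧ ∀ X' Y' L' : ℕ → ℕ, BlkV n p X' Y' L' →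
      ¬ ∑ i ∈ Finset.range n, L i < ∑ i ∈ Finset.range n, L' i := by
    have bd : ∀ X Y L : ℕ → ℕ, BlkV n p X Y L → ∑ i ∈ Finset.range n, L i ≤ n * n := by
      intro X Y L h
      have := Finset.sum_le_card_nsmul (Finset.range n) L n (fun i hi => by
        have := (h.sep i (Finset.mem_range.1 hi)).pos; omega)
      simpa using this
    intro m
    induction m with
    | zero =>
      intro X Y L h hm
      refine ⟨X, Y, L, h, fun X' Y' L' h' => ?_⟩
      have := bd X' Y' L' h'
      omega
    | succ m ih =>
      intro X Y L h hm
      by_cases hc : ∃ X' Y' L' : ℕ → ℕ, BlkV n p X' Y' L' ∧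
        ∑ i ∈ Finset.range n, L i < ∑ i ∈ Finset.range n, L' i
      · obtain ⟨X', Y', L', h', hlt⟩ := hc
        exact ih X' Y' L' h' (by omega)
      · exact ⟨X, Y, L, h, fun X' Y' L' h' hlt => hc ⟨X', Y', L', h', hlt⟩⟩
  refine key _ (fun i => i) p (fun _ => 1) ⟨fun i hi => .base i hi, fun i hi => by simp, ?_⟩ le_rfl
  intro i hi j h1 h2
  obtain rfl : j = i := by omega
  simp

/-- Extension of a permutation of `Fin n` to a function on naturals. -/
def extP {n : ℕ} (π : Equiv.Perm (Fin n)) (i : ℕ) : ℕ := if h : i < n then (π ⟨i, h⟩ : ℕ) else i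

theorem extP_inj {n : ℕ} (π : Equiv.Perm (Fin n)) {i j : ℕ} (hi : i < n) (hj : j < n)
    (h : extP π i = extP π j) : i = j := by
  simp only [extP, hi, hj, dif_pos] at h
  have := π.injective (Fin.ext h)
  simpa using this

theorem full_of_sep {n : ℕ} (π : Equiv.Perm (Fin n)) (h : SepB n (extP π) 0 0 n) : Full π := by
  apply Set.eq_univ_of_forall
  rintro ⟨c1, c2⟩ S ⟨hg, hS⟩
  have := h.fill (fun u v => ∃ (hu : u < n) (hv : v < n),
      ((⟨u, hu⟩, ⟨v, hv⟩) : Fin n × Fin n) ∈ S) ?_ ?_ ?_ c1 c2 (by omega) (by omega) (by omega)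
      (by omega)
  · obtain ⟨_, _, h⟩ := this
    exact h
  · intro i hi
    have e : extP π i = π ⟨i, hi⟩ := by simp [extP, hi]
    refine ⟨hi, by rw [e]; exact Fin.isLt _, hg ?_⟩
    simp only [graphOf, Set.mem_ofPred_eq, Fin.ext_iff, e]
  · rintro u v ⟨hu, hv, h1⟩ ⟨hu', hv', h2⟩
    refine ⟨⟨hu, hv', hS _ ⟨_, h1, _, h2, ?_, ?_, ?_⟩⟩, ⟨hu', hv, hS _ ⟨_, h1, _, h2, ?_, ?_, ?_⟩⟩⟩ <;>
      simp [Adj]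
  · rintro u v ⟨hu, hv, h1⟩ ⟨hu', hv', h2⟩
    refine ⟨⟨hu, hv', hS _ ⟨_, h1, _, h2, ?_, ?_, ?_⟩⟩, ⟨hu', hv, hS _ ⟨_, h1, _, h2, ?_, ?_, ?_⟩⟩⟩ <;>
      simp [Adj]

theorem sep_of_full {n : ℕ} (hn : 1 ≤ n) (π : Equiv.Perm (Fin n)) (hf : Full π) :
    SepB n (extP π) 0 0 n := by
  obtain ⟨X, Y, L, h, hmax⟩ := exists_maxBlk n (extP π)
  let U : Set (Fin n × Fin n) := {c | Y c.1 ≤ c.2 ∧ (c.2 : ℕ) < Y c.1 + L c.1}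
  have hU : ∀ c, c ∈ U := by
    intro c
    have hc : c ∈ percClosure π := by rw [hf]; trivial
    refine hc U ⟨?_, ?_⟩
    · rintro ⟨i, j⟩ (hij : j = π i)
      subst hij
      have m := h.mem i i.2
      have := (h.sep i i.2).maps i m.1 m.2
      simpa [extP, U] using this
    · rintro ⟨c1, c2⟩ ⟨⟨d1, d2⟩, hd, ⟨e1, e2⟩, he, hne, a1, a2⟩
      simp only [U, Set.mem_ofPred_eq] at hd he ⊢
      have hne' : (d1 : ℕ) ≠ e1 ∨ (d2 : ℕ) ≠ e2 := by
        by_contra hc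
        push Not at hc
        exact hne (Prod.ext (Fin.ext hc.1) (Fin.ext hc.2))
      simp only [Adj, Fin.ext_iff] at a1 a2
      obtain ⟨c1, hc1⟩ := c1
      obtain ⟨c2, hc2⟩ := c2
      obtain ⟨d1, hd1⟩ := d1
      obtain ⟨d2, hd2⟩ := d2
      obtain ⟨e1, he1⟩ := e1
      obtain ⟨e2, he2⟩ := e2
      simp only at *
      have md := h.mem d1 hd1
      have me := h.mem e1 he1
      by_cases hX : X d1 = X e1
      · have k1 := h.con d1 hd1 (X d1) le_rfl (by omega)
        have k2 := h.con e1 he1 (X d1) (by omega) (by omega)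
        have k3 := h.con d1 hd1 c1
        have : X d1 ≤ c1 ∧ c1 < X d1 + L d1 := by omega
        have := k3 this.1 this.2
        omega
      · exfalso
        have hdis : ∀ j, Y d1 ≤ j → j < Y d1 + L d1 → Y e1 ≤ j → j < Y e1 + L e1 → False := by
          intro j h1 h2 h3 h4
          obtain ⟨r, r1, r2, r3⟩ := (h.sep d1 hd1).surj j h1 h2
          obtain ⟨s, s1, s2, s3⟩ := (h.sep e1 he1).surj j h3 h4
          have pd := (h.sep d1 hd1).pos
          have pe := (h.sep e1 he1).pos
          have hrs := extP_inj π (by omega) (by omega) (r3.trans s3.symm)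
          subst hrs
          have q1 := h.con d1 hd1 r r1 r2
          have q2 := h.con e1 he1 r s1 s2
          omega
        have hr : d1 ≠ e1 := fun hc => hX (by rw [hc])
        have hcc : d2 ≠ e2 := fun hc => hdis d2 hd.1 hd.2 (by omega) (by omega)
        have hv : d2 + 1 = e2 ∨ e2 + 1 = d2 := by omega
        have hw : d1 + 1 = e1 ∨ e1 + 1 = d1 := by omega
        rcases hw with hw | hw
        · obtain ⟨X', Y', L', h', hlt⟩ := h.merge2 d1 e1 d2 e2 hd1 he1 hw hX hd he hv hdis
          exact hmax _ _ _ h' hlt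
        · obtain ⟨X', Y', L', h', hlt⟩ := h.merge2 e1 d1 e2 d2 he1 hd1 hw (Ne.symm hX) he hd hv.symm
            (fun j h1 h2 h3 h4 => hdis j h3 h4 h1 h2)
          exact hmax _ _ _ h' hlt
  have u1 := hU (⟨0, hn⟩, ⟨0, hn⟩)
  have u2 := hU (⟨0, hn⟩, ⟨n - 1, by omega⟩)
  simp only [U, Set.mem_ofPred_eq] at u1 u2
  have m := h.mem 0 hn
  have s := h.sep 0 hn
  have pp := s.pos
  exact s.cast (by omega) (by omega) (by omega)

theorem sep_split {n k : ℕ} {p q r : ℕ → ℕ} (hk : k < n)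
    (hq : ∀ i, i < k → q i = p i) (hr : ∀ i, k ≤ i → i < n → p i = k + r (i - k))
    (hp : ∀ i, i < k → p i < k) {x y l : ℕ} (h : SepB n p x y l) :
    (x + l ≤ k → SepB k q x y l) ∧
    (k ≤ x → k ≤ y ∧ SepB (n - k) r (x - k) (y - k) l) ∧
    (x < k → k < x + l → y = x ∧ SepB k q x y (k - x) ∧ SepB (n - k) r 0 0 (x + l - k)) := by
  induction h with
  | base i h =>
    refine ⟨fun h1 => ?_, fun h1 => ?_, fun h1 h2 => by omega⟩
    · exact (SepB.base i (by omega)).cast rfl (hq i (by omega)) rfl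
    · have := hr i h1 h
      exact ⟨by omega, (SepB.base (i - k) (by omega)).cast rfl (by omega) rfl⟩
  | diag x y a b h1 h2 ih1 ih2 =>
    have p1 := h1.pos
    have p2 := h2.pos
    obtain ⟨A1, A2, A3⟩ := ih1
    obtain ⟨B1, B2, B3⟩ := ih2
    refine ⟨fun h => .diag _ _ _ _ (A1 (by omega)) (B1 (by omega)), fun h => ?_, fun h h' => ?_⟩
    · obtain ⟨_, S1⟩ := A2 h
      obtain ⟨_, S2⟩ := B2 (by omega)
      exact ⟨by omega, .diag _ _ _ _ S1 (S2.cast (by omega) (by omega) rfl)⟩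
    · rcases lt_trichotomy (x + a) k with hc | hc | hc
      · have S1 := A1 hc.le
        obtain ⟨e, S2, S3⟩ := B3 hc (by omega)
        refine ⟨by omega, (SepB.diag _ _ _ _ S1 S2).cast rfl rfl (by omega), 
          S3.cast rfl rfl (by omega)⟩
      · have S1 := A1 hc.le
        obtain ⟨e, S2⟩ := B2 hc.ge
        obtain ⟨i, i1, i2, i3⟩ := h1.surj (y + a - 1) (by omega) (by omega)
        have := hp i (by omega)
        refine ⟨by omega, S1.cast rfl rfl (by omega), 
          S2.cast (by omega) (by omega) (by omega)⟩
      · obtain ⟨e, S1, S2⟩ := A3 h hc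
        obtain ⟨_, S3⟩ := B2 hc.le
        exact ⟨e, S1, (SepB.diag 0 0 _ _ S2 (S3.cast (by omega) (by omega) rfl)).cast rfl rfl
          (by omega)⟩
  | anti x y a b h1 h2 ih1 ih2 =>
    have p1 := h1.pos
    have p2 := h2.pos
    obtain ⟨A1, A2, A3⟩ := ih1
    obtain ⟨B1, B2, B3⟩ := ih2
    refine ⟨fun h => .anti _ _ _ _ (A1 (by omega)) (B1 (by omega)), fun h => ?_, fun h h' => ?_⟩
    · obtain ⟨_, S1⟩ := A2 h
      obtain ⟨_, S2⟩ := B2 (by omega)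
      exact ⟨by omega, .anti _ _ _ _ (S1.cast rfl (by omega) rfl) (S2.cast (by omega) rfl rfl)⟩
    · exfalso
      have e1 := h1.maps x (by omega) (by omega)
      have e2 := h2.maps (x + a + b - 1) (by omega) (by omega)
      have e3 := hp x h
      have e4 := hr (x + a + b - 1) (by omega) (by omega)
      omega

theorem sep_lift1 {n k : ℕ} {p q : ℕ → ℕ} (hk : k < n)
    (hq : ∀ i, i < k → q i = p i) {x y l : ℕ} (h : SepB k q x y l) : SepB n p x y l := by
  induction h with
  | base i h => exact (SepB.base i (by omega)).cast rfl (hq i h).symm rfl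
  | diag x y a b h1 h2 ih1 ih2 => exact .diag _ _ _ _ ih1 ih2
  | anti x y a b h1 h2 ih1 ih2 => exact .anti _ _ _ _ ih1 ih2

theorem sep_lift2 {n k : ℕ} {p r : ℕ → ℕ} 
    (hr : ∀ i, k ≤ i → i < n → p i = k + r (i - k)) {x y l : ℕ}
    (h : SepB (n - k) r x y l) : SepB n p (k + x) (k + y) l := by
  induction h with
  | base i h =>
    refine (SepB.base (k + i) (by omega)).cast rfl ?_ rfl
    rw [hr _ (by omega) (by omega)]; simp
  | diag x y a b h1 h2 ih1 ih2 =>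
    exact .diag _ _ _ _ ih1 (ih2.cast (by omega) (by omega) rfl)
  | anti x y a b h1 h2 ih1 ih2 =>
    exact .anti _ _ _ _ (ih1.cast rfl (by omega) rfl) (ih2.cast (by omega) rfl rfl)

theorem stmt_11 (n : ℕ) (hn : 2 ≤ n) (π : Equiv.Perm (Fin n))
    (k : ℕ) (hk1 : 1 ≤ k) (hk : k < n)
    (himg : (fun i => π i) '' {i : Fin n | (i : ℕ) < k} = {i : Fin n | (i : ℕ) < k})
    (σ : Equiv.Perm (Fin k)) (τ : Equiv.Perm (Fin (n - k)))
    (hσ : ∀ i : Fin k, (σ i : ℕ) = ((π ⟨(i : ℕ), i.isLt.trans hk⟩ : Fin n) : ℕ))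
    (hτ : ∀ i : Fin (n - k), (τ i : ℕ) =
        ((π ⟨k + (i : ℕ), by have := i.isLt; omega⟩ : Fin n) : ℕ) - k) :
    Full π ↔ (Full σ ∧ Full τ) := by
  have hq : ∀ i, i < k → extP σ i = extP π i := by
    intro i hi
    have := hσ ⟨i, hi⟩
    simpa [extP, hi, hi.trans hk] using this
  have hp : ∀ i, i < k → extP π i < k := by
    intro i hi
    rw [← hq i hi]
    simp [extP, hi]
  have hge : ∀ i : Fin n, k ≤ (i : ℕ) → k ≤ (π i : ℕ) := by
    intro i hi
    by_contra hc
    have : π i ∈ (fun i => π i) '' {i : Fin n | (i : ℕ) < k} := by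
      rw [himg]; simpa using hc
    obtain ⟨j, hj, hji⟩ := this
    have := π.injective hji
    subst this
    simp only [Set.mem_ofPred_eq] at hj
    omega
  have hr : ∀ i, k ≤ i → i < n → extP π i = k + extP τ (i - k) := by
    intro i h1 h2
    have h3 : i - k < n - k := by omega
    have a1 := hτ ⟨i - k, h3⟩
    have a2 := hge ⟨i, h2⟩ h1
    have a3 : k + (i - k) = i := by omega
    simp only [a3] at a1
    simp only [extP, h2, h3, dif_pos, a1]
    omega
  constructor
  · intro hf
    have := (sep_split hk hq hr hp (sep_of_full (by omega) π hf)).2.2 (by omega) (by omega)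
    exact ⟨full_of_sep σ (this.2.1.cast rfl rfl (by omega)),
      full_of_sep τ (this.2.2.cast rfl rfl (by omega))⟩
  · rintro ⟨h1, h2⟩
    have s1 := sep_lift1 hk hq (sep_of_full hk1 σ h1)
    have s2 := sep_lift2 hr (sep_of_full (by omega) τ h2)
    exact full_of_sep π ((SepB.diag 0 0 k (n - k) s1 (s2.cast (by omega) (by omega) rfl)).cast
      rfl rfl (by omega))
end

section
/- Let p n denote the number of full permutations of Fin n and q n the number of full indecomposable permutations of Fin n. Then p 1 = q 1 = 1, and for every n ≥ 0, p (n+2) = q (n+2) + ∑_{k=1}^{n+1} q k · p (n+2−k). -/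
/-- The number of full permutations of `Fin m`. -/
noncomputable def numFull (m : ℕ) : ℕ :=
  Nat.card {π : Equiv.Perm (Fin m) // Full π}

/-- The number of full indecomposable permutations of `Fin m`. -/
noncomputable def numFullIndec (m : ℕ) : ℕ :=
  Nat.card {π : Equiv.Perm (Fin m) // Full π ∧ Indecomposable π}

def NAdj (i j i' j' : ℕ) : Prop :=
  (i = i' ∧ (j + 1 = j' ∨ j' + 1 = j)) ∨ (j = j' ∧ (i + 1 = i' ∨ i' + 1 = i))

def PC (n : ℕ) (S : ℕ → ℕ → Prop) : Prop :=
  ∀ i j i1 j1 i2 j2, i < n → j < n → i1 < n → j1 < n → i2 < n → j2 < n →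
    S i1 j1 → S i2 j2 → NAdj i j i1 j1 → NAdj i j i2 j2 → ¬ (i1 = i2 ∧ j1 = j2) → S i j

def IsP (n : ℕ) (f : ℕ → ℕ) : Prop := (∀ i < n, f i < n) ∧ ∀ j < n, ∃ i < n, f i = j

def CC (n : ℕ) (f : ℕ → ℕ) (i j : ℕ) : Prop :=
  ∀ S, PC n S → (∀ i < n, S i (f i)) → S i j

def NFull (n : ℕ) (f : ℕ → ℕ) : Prop := ∀ i < n, ∀ j < n, CC n f i j

theorem CC_PC (n : ℕ) (f : ℕ → ℕ) : PC n (CC n f) := by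
  intro i j i1 j1 i2 j2 a b c d e g h1 h2 x y z S hS hg
  exact hS i j i1 j1 i2 j2 a b c d e g (h1 S hS hg) (h2 S hS hg) x y z

theorem PC_swap {n : ℕ} {S : ℕ → ℕ → Prop} (h : PC n S) : PC n (fun i j => S j i) := by
  intro i j i1 j1 i2 j2 a b c d e g h1 h2 x y z
  refine h j i j1 i1 j2 i2 b a d c g e h1 h2 ?_ ?_ ?_
  · unfold NAdj at *; omega
  · unfold NAdj at *; omega
  · omega

theorem strip {n : ℕ} {S : ℕ → ℕ → Prop} (h : PC n S) (i i' c d j0 : ℕ)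
    (hi : i < n) (hi' : i' < n) (hd : d ≤ n) (hadj : i + 1 = i' ∨ i' + 1 = i)
    (hrow : ∀ j, c ≤ j → j < d → S i' j) (hc : c ≤ j0) (hj : j0 < d) (h0 : S i j0) :
    ∀ j, c ≤ j → j < d → S i j := by
  have key : ∀ t j, (j + t = j0 ∨ j = j0 + t) → c ≤ j → j < d → S i j := by
    intro t
    induction t with
    | zero => intro j hj _ _; have : j = j0 := by omega
              rw [this]; exact h0
    | succ t ih =>
      intro j hjt h1 h2
      rcases hjt with hjt | hjt
      · refine h i j i (j+1) i' j hi (by omega) hi (by omega) hi' (by omega)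
          (ih (j+1) (by omega) (by omega) (by omega)) (hrow j h1 h2) ?_ ?_ ?_
        · unfold NAdj; omega
        · unfold NAdj; omega
        · omega
      · refine h i j i (j-1) i' j hi (by omega) hi (by omega) hi' (by omega)
          (ih (j-1) (by omega) (by omega) (by omega)) (hrow j h1 h2) ?_ ?_ ?_
        · unfold NAdj; omega
        · unfold NAdj; omega
        · omega
  intro j h1 h2
  rcases le_total j j0 with hl | hl
  · exact key (j0 - j) j (by omega) h1 h2
  · exact key (j - j0) j (by omega) h1 h2

theorem cross {n : ℕ} {S : ℕ → ℕ → Prop} (h : PC n S) (a b c d i0 j0 : ℕ)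
    (hb : b ≤ n) (hd : d ≤ n) (hi1 : a ≤ i0) (hi2 : i0 < b) (hj1 : c ≤ j0) (hj2 : j0 < d)
    (hrow : ∀ j, c ≤ j → j < d → S i0 j) (hcol : ∀ i, a ≤ i → i < b → S i j0) :
    ∀ i j, a ≤ i → i < b → c ≤ j → j < d → S i j := by
  have key : ∀ t i, (i + t = i0 ∨ i = i0 + t) → a ≤ i → i < b →
      ∀ j, c ≤ j → j < d → S i j := by
    intro t
    induction t with
    | zero => intro i hj _ _; have : i = i0 := by omega
              rw [this]; exact hrow
    | succ t ih =>
      intro i hit h1 h2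
      rcases hit with hit | hit
      · exact strip h i (i+1) c d j0 (by omega) (by omega) hd (by omega)
          (ih (i+1) (by omega) (by omega) (by omega)) hj1 hj2 (hcol i h1 h2)
      · exact strip h i (i-1) c d j0 (by omega) (by omega) hd (by omega)
          (ih (i-1) (by omega) (by omega) (by omega)) hj1 hj2 (hcol i h1 h2)
  intro i j h1 h2
  rcases le_total i i0 with hl | hl
  · exact key (i0 - i) i (by omega) h1 h2 j
  · exact key (i - i0) i (by omega) h1 h2 j

def BoxIn (S : ℕ → ℕ → Prop) (a b c d : ℕ) : Prop :=
  ∀ i j, a ≤ i → i < b → c ≤ j → j < d → S i j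

/-- corner filling: diagonal neighbours -/
theorem corner {n : ℕ} {S : ℕ → ℕ → Prop} (h : PC n S) (a b c d a' b' c' d' i j i' j' : ℕ)
    (hb : b ≤ n) (hd : d ≤ n) (hb' : b' ≤ n) (hd' : d' ≤ n)
    (h1 : BoxIn S a b c d) (h2 : BoxIn S a' b' c' d')
    (hi : a ≤ i ∧ i < b) (hj : c ≤ j ∧ j < d) (hi' : a' ≤ i' ∧ i' < b')
    (hj' : c' ≤ j' ∧ j' < d')
    (hii : i + 1 = i' ∨ i' + 1 = i) (hjj : j + 1 = j' ∨ j' + 1 = j) :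
    BoxIn S a' b' c d := by
  have h0 : S i' j := by
    refine h i' j i j i' j' (by omega) (by omega) (by omega) (by omega) (by omega) (by omega)
      (h1 i j (by omega) (by omega) (by omega) (by omega))
      (h2 i' j' (by omega) (by omega) (by omega) (by omega)) ?_ ?_ ?_
    · unfold NAdj; omega
    · unfold NAdj; omega
    · omega
  refine cross h a' b' c d i' j hb' hd hi'.1 hi'.2 hj.1 hj.2 ?_ ?_
  · exact strip h i' i c d j (by omega) (by omega) hd (by omega)
      (fun x hx hx' => h1 i x hi.1 hi.2 hx hx') hj.1 hj.2 h0
  · exact strip (PC_swap h) j j' a' b' i' (by omega) (by omega) hb' (by omega)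
      (fun x hx hx' => h2 x j' hx hx' hj'.1 hj'.2) hi'.1 hi'.2 h0

structure Good_s12 (n : ℕ) (f : ℕ → ℕ) (a b c d : ℕ) : Prop where
  hb : b ≤ n
  hd : d ≤ n
  iff : ∀ i < n, ((a ≤ i ∧ i < b) ↔ (c ≤ f i ∧ f i < d))
  box : BoxIn (CC n f) a b c d

theorem merge_inter {n : ℕ} {f : ℕ → ℕ} (a b c d a' b' c' d' i : ℕ)
    (h1 : Good_s12 n f a b c d) (h2 : Good_s12 n f a' b' c' d')
    (hi : a ≤ i ∧ i < b) (hi' : a' ≤ i ∧ i < b') :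
    Good_s12 n f (min a a') (max b b') (min c c') (max d d') := by
  have hb := h1.hb
  have hd := h1.hd
  have hb' := h2.hb
  have hd' := h2.hd
  have hj := (h1.iff i (by omega)).1 hi
  have hj' := (h2.iff i (by omega)).1 hi'
  refine ⟨by omega, by omega, ?_, ?_⟩
  · intro x hx
    have e1 := h1.iff x hx
    have e2 := h2.iff x hx
    omega
  · have A : BoxIn (CC n f) a' b' c d :=
      cross (CC_PC n f) a' b' c d i (f i) hb' hd hi'.1 hi'.2 hj.1 hj.2
        (fun x hx hx' => h1.box i x hi.1 hi.2 hx hx')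
        (fun x hx hx' => h2.box x (f i) hx hx' hj'.1 hj'.2)
    have B : BoxIn (CC n f) a b c' d' :=
      cross (CC_PC n f) a b c' d' i (f i) hb hd' hi.1 hi.2 hj'.1 hj'.2
        (fun x hx hx' => h2.box i x hi'.1 hi'.2 hx hx')
        (fun x hx hx' => h1.box x (f i) hx hx' hj.1 hj.2)
    intro x y hx1 hx2 hy1 hy2
    have hx : (a ≤ x ∧ x < b) ∨ (a' ≤ x ∧ x < b') := by omega
    have hy : (c ≤ y ∧ y < d) ∨ (c' ≤ y ∧ y < d') := by omega
    rcases hx with hx | hx <;> rcases hy with hy | hy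
    · exact h1.box x y hx.1 hx.2 hy.1 hy.2
    · exact B x y hx.1 hx.2 hy.1 hy.2
    · exact A x y hx.1 hx.2 hy.1 hy.2
    · exact h2.box x y hx.1 hx.2 hy.1 hy.2

theorem merge_diag {n : ℕ} {f : ℕ → ℕ} (a b c d a' b' c' d' i j i' j' : ℕ)
    (h1 : Good_s12 n f a b c d) (h2 : Good_s12 n f a' b' c' d')
    (hi : a ≤ i ∧ i < b) (hj : c ≤ j ∧ j < d) (hi' : a' ≤ i' ∧ i' < b')
    (hj' : c' ≤ j' ∧ j' < d')
    (hii : i + 1 = i' ∨ i' + 1 = i) (hjj : j + 1 = j' ∨ j' + 1 = j) :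
    Good_s12 n f (min a a') (max b b') (min c c') (max d d') := by
  have hb := h1.hb
  have hd := h1.hd
  have hb' := h2.hb
  have hd' := h2.hd
  refine ⟨by omega, by omega, ?_, ?_⟩
  · intro x hx
    have e1 := h1.iff x hx
    have e2 := h2.iff x hx
    omega
  · have A : BoxIn (CC n f) a' b' c d :=
      corner (CC_PC n f) a b c d a' b' c' d' i j i' j' hb hd hb' hd' h1.box h2.box
        hi hj hi' hj' hii hjj
    have B : BoxIn (CC n f) a b c' d' :=
      corner (CC_PC n f) a' b' c' d' a b c d i' j' i j hb' hd' hb hd h2.box h1.box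
        hi' hj' hi hj (by omega) (by omega)
    intro x y hx1 hx2 hy1 hy2
    have hx : (a ≤ x ∧ x < b) ∨ (a' ≤ x ∧ x < b') := by omega
    have hy : (c ≤ y ∧ y < d) ∨ (c' ≤ y ∧ y < d') := by omega
    rcases hx with hx | hx <;> rcases hy with hy | hy
    · exact h1.box x y hx.1 hx.2 hy.1 hy.2
    · exact B x y hx.1 hx.2 hy.1 hy.2
    · exact A x y hx.1 hx.2 hy.1 hy.2
    · exact h2.box x y hx.1 hx.2 hy.1 hy.2

def UU (n : ℕ) (f : ℕ → ℕ) (i j : ℕ) : Prop :=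
  ∃ a b c d, Good_s12 n f a b c d ∧ (a ≤ i ∧ i < b) ∧ (c ≤ j ∧ j < d)

theorem UU_graph {n : ℕ} {f : ℕ → ℕ} (hf : IsP n f) (inj : ∀ i < n, ∀ j < n, f i = f j → i = j) :
    ∀ i < n, UU n f i (f i) := by
  intro i hi
  refine ⟨i, i+1, f i, f i + 1, ⟨by omega, hf.1 i hi, ?_, ?_⟩, by omega, by omega⟩
  · intro x hx
    constructor
    · intro h
      have : x = i := by omega
      subst this; omega
    · intro h
      have := inj x hx i hi (by omega)
      omega
  · intro x y h1 h2 h3 h4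
    have e1 : x = i := by omega
    have e2 : y = f i := by omega
    subst e1 e2
    intro S _ hS
    exact hS x hi

theorem UU_PC {n : ℕ} {f : ℕ → ℕ} (hf : IsP n f) : PC n (UU n f) := by
  intro i j i1 j1 i2 j2 hi hj hi1 hj1 hi2 hj2 ⟨a, b, c, d, h1, hr1, hc1⟩ ⟨a', b', c', d', h2, hr2, hc2⟩ x y z
  by_cases hI : ∃ r, (a ≤ r ∧ r < b) ∧ (a' ≤ r ∧ r < b')
  · obtain ⟨r, q1, q2⟩ := hI
    refine ⟨_, _, _, _, merge_inter a b c d a' b' c' d' r h1 h2 q1 q2, ?_⟩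
    unfold NAdj at *
    omega
  · have hJ : ¬ ∃ r, (c ≤ r ∧ r < d) ∧ (c' ≤ r ∧ r < d') := by
      rintro ⟨r, q1, q2⟩
      obtain ⟨s, hs, e⟩ := hf.2 r (lt_of_lt_of_le q1.2 h1.hd)
      subst e
      exact hI ⟨s, (h1.iff s hs).2 q1, (h2.iff s hs).2 q2⟩
    have n1 : i1 ≠ i2 := fun e => hI ⟨i1, hr1, e ▸ hr2⟩
    have n2 : j1 ≠ j2 := fun e => hJ ⟨j1, hc1, e ▸ hc2⟩
    refine ⟨_, _, _, _, merge_diag a b c d a' b' c' d' i1 j1 i2 j2 h1 h2 hr1 hc1 hr2 hc2 ?_ ?_, ?_⟩ <;>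
    · unfold NAdj at *
      omega

theorem CC_UU {n : ℕ} {f : ℕ → ℕ} (hf : IsP n f) (inj : ∀ i < n, ∀ j < n, f i = f j → i = j)
    {i j : ℕ} (h : CC n f i j) : UU n f i j :=
  h _ (UU_PC hf) (UU_graph hf inj)

theorem sum_left {n k : ℕ} {f s : ℕ → ℕ} (hk : k ≤ n) (hs : IsP k s)
    (inj : ∀ i < k, ∀ j < k, s i = s j → i = j)
    (h1 : ∀ i < k, f i = s i) (h2 : ∀ i, k ≤ i → i < n → k ≤ f i ∧ f i < n)
    (hF : NFull n f) : NFull k s := by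
  classical
  have ex : ∃ t, ∃ a c, a ≤ k ∧ c ≤ k ∧ a + c = t ∧ Good_s12 k s a k c k := by
    refine ⟨k + k, k, k, le_rfl, le_rfl, rfl, ⟨le_rfl, le_rfl, ?_, ?_⟩⟩
    · intro i hi; omega
    · intro i j; omega
  obtain ⟨a, c, ha, hc, hac, hG⟩ := Nat.find_spec ex
  have hmin : ∀ a' c', a' ≤ k → c' ≤ k → Good_s12 k s a' k c' k → a + c ≤ a' + c' := by
    intro a' c' ha' hc' hg
    rw [hac]
    exact Nat.find_min' ex ⟨a', c', ha', hc', rfl, hg⟩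
  -- dichotomy
  have dich : ∀ i j, i < k → j < k → CC k s i j → (i < a ∧ j < c) ∨ (a ≤ i ∧ c ≤ j) := by
    intro i j hi hj hC
    obtain ⟨a', b', c', d', hG', hr, hcl⟩ := CC_UU hs inj hC
    by_contra hcon
    have : ∃ r, (a ≤ r ∧ r < k) ∧ (a' ≤ r ∧ r < b') := by
      by_cases hia : a ≤ i
      · exact ⟨i, ⟨hia, hi⟩, hr⟩
      · have hjc : c ≤ j := by omega
        obtain ⟨x, hx, e⟩ := hs.2 j hj
        subst e
        exact ⟨x, (hG.iff x hx).2 ⟨hjc, hj⟩, (hG'.iff x hx).2 hcl⟩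
    obtain ⟨r, q1, q2⟩ := this
    have hM := merge_inter a k c k a' b' c' d' r hG hG' q1 q2
    have e1 : max k b' = k := by have := hG'.hb; omega
    have e2 : max k d' = k := by have := hG'.hd; omega
    rw [e1, e2] at hM
    have := hmin _ _ (by omega) (by omega) hM
    omega
  have hcorner : 1 ≤ a → 1 ≤ c → ¬ CC k s (a-1) (c-1) := by
    intro ha1 hc1 hC
    by_cases hak : a = k
    · have hck : c = k := by
        by_contra hne
        obtain ⟨x, hx, e⟩ := hs.2 c (by omega)
        have := (hG.iff x hx).2 (by omega)
        omega
      obtain ⟨a', b', c', d', hG', hr, hcl⟩ := CC_UU hs inj hC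
      have := hG'.hb
      have := hG'.hd
      have e1 : b' = k := by omega
      have e2 : d' = k := by omega
      subst e1
      rw [e2] at hG'
      have := hmin _ _ (by omega) (by omega) hG'
      omega
    · have hck : c < k := by
        have := (hG.iff a (by omega)).1 (by omega)
        omega
      have hC2 : CC k s a c := hG.box a c le_rfl (by omega) le_rfl hck
      have hC3 : CC k s (a-1) c := by
        refine CC_PC k s (a-1) c (a-1) (c-1) a c (by omega) (by omega) (by omega) (by omega)
          (by omega) (by omega) hC hC2 ?_ ?_ ?_ <;>
        · try unfold NAdj
          omega
      have := dich (a-1) c (by omega) hck hC3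
      omega
  -- the closed set
  let S : ℕ → ℕ → Prop := fun i j => (i < a ∧ j < c ∧ CC k s i j) ∨ (a ≤ i ∧ c ≤ j)
  have hS : PC n S := by
    intro i j i1 j1 i2 j2 hi hj hi1 hj1 hi2 hj2 q1 q2 x y z
    by_cases hreg : a ≤ i ∧ c ≤ j
    · exact Or.inr hreg
    by_cases hreg' : i < a ∧ j < c
    · have nn1 : ¬ (a ≤ i1 ∧ c ≤ j1) := by unfold NAdj at *; omega
      have nn2 : ¬ (a ≤ i2 ∧ c ≤ j2) := by unfold NAdj at *; omega
      rcases q1 with q1 | q1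
      · rcases q2 with q2 | q2
        · exact Or.inl ⟨hreg'.1, hreg'.2, CC_PC k s i j i1 j1 i2 j2 (by omega) (by omega) (by omega)
            (by omega) (by omega) (by omega) q1.2.2 q2.2.2 x y z⟩
        · exact absurd q2 nn2
      · exact absurd q1 nn1
    · exfalso
      rcases q1 with ⟨u1, u2, u3⟩ | q1 <;> rcases q2 with ⟨v1, v2, v3⟩ | q2
      · unfold NAdj at *; omega
      · have e1 : i1 = a - 1 := by unfold NAdj at *; omega
        have e2 : j1 = c - 1 := by unfold NAdj at *; omega
        subst e1 e2
        exact hcorner (by omega) (by omega) u3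
      · have e1 : i2 = a - 1 := by unfold NAdj at *; omega
        have e2 : j2 = c - 1 := by unfold NAdj at *; omega
        subst e1 e2
        exact hcorner (by omega) (by omega) v3
      · unfold NAdj at *; omega
  have hgr : ∀ i < n, S i (f i) := by
    intro i hi
    by_cases hik : i < k
    · rw [h1 i hik]
      have hC : CC k s i (s i) := fun T _ hT => hT i hik
      rcases dich i (s i) hik (hs.1 i hik) hC with h | h
      · exact Or.inl ⟨h.1, h.2, hC⟩
      · exact Or.inr h
    · have := h2 i (by omega) hi
      exact Or.inr (by omega)
  rcases Nat.eq_zero_or_pos k with hk0 | hkpos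
  · intro i hi; omega
  have hz : a = 0 ∧ c = 0 := by
    by_contra hne
    by_cases ha0 : a = 0
    · rcases hF 0 (by omega) 0 (by omega) S hS hgr with h | h <;> omega
    · by_cases hc0 : c = 0
      · rcases hF 0 (by omega) 0 (by omega) S hS hgr with h | h <;> omega
      · by_cases hak : a = k
        · by_cases hck : c = k
          · have h3 := hF (a-1) (by omega) (c-1) (by omega) S hS hgr
            rcases h3 with h | h
            · exact hcorner (by omega) (by omega) h.2.2
            · omega
          · rcases hF 0 (by omega) c (by omega) S hS hgr with h | h <;> omega
        · rcases hF a (by omega) 0 (by omega) S hS hgr with h | h <;> omega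
  intro i hi j hj
  exact hG.box i j (by omega) hi (by omega) hj

def nrev (n : ℕ) (f : ℕ → ℕ) : ℕ → ℕ := fun i => n - 1 - f (n - 1 - i)

theorem NFull_rev {n : ℕ} {f : ℕ → ℕ} (hf : ∀ i < n, f i < n) (h : NFull n f) :
    NFull n (nrev n f) := by
  intro i hi j hj S hS hg
  have := h (n-1-i) (by omega) (n-1-j) (by omega) (fun x y => S (n-1-x) (n-1-y)) ?_ ?_
  · have e1 : n - 1 - (n - 1 - i) = i := by omega
    have e2 : n - 1 - (n - 1 - j) = j := by omega
    simpa [e1, e2] using this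
  · intro i j i1 j1 i2 j2 a b c d e g h1 h2 x y z
    refine hS _ _ _ _ _ _ (by omega) (by omega) (by omega) (by omega) (by omega) (by omega) h1 h2 ?_ ?_ ?_
      <;> (unfold NAdj at *; omega)
  · intro x hx
    have := hg (n-1-x) (by omega)
    unfold nrev at this
    have e1 : n - 1 - (n - 1 - x) = x := by omega
    rw [e1] at this
    exact this

theorem NFull_congr {n : ℕ} {f g : ℕ → ℕ} (h : ∀ i < n, f i = g i) (hf : NFull n f) : NFull n g := by
  intro i hi j hj S hS hg
  exact hf i hi j hj S hS (fun x hx => h x hx ▸ hg x hx)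

theorem NFull_sum {k m : ℕ} {f s t : ℕ → ℕ}
    (hs : IsP k s) (injs : ∀ i < k, ∀ j < k, s i = s j → i = j)
    (ht : IsP m t) (injt : ∀ i < m, ∀ j < m, t i = t j → i = j)
    (h1 : ∀ i < k, f i = s i) (h2 : ∀ i < m, f (k + i) = k + t i) :
    NFull (k + m) f ↔ NFull k s ∧ NFull m t := by
  have hf : ∀ i < k + m, f i < k + m := by
    intro i hi
    by_cases hik : i < k
    · rw [h1 i hik]; have := hs.1 i hik; omega
    · have e := h2 (i - k) (by omega)
      have := ht.1 (i-k) (by omega)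
      have e1 : k + (i - k) = i := by omega
      rw [e1] at e; omega
  constructor
  · intro hF
    constructor
    · refine sum_left (Nat.le_add_right k m) hs injs h1 ?_ hF
      intro i hik hi
      have e := h2 (i - k) (by omega)
      have := ht.1 (i-k) (by omega)
      have e1 : k + (i - k) = i := by omega
      rw [e1] at e; omega
    · have hR := NFull_rev hf hF
      have : NFull m (nrev m t) := by
        refine sum_left (n := k + m) (f := nrev (k+m) f) (by omega) ?_ ?_ ?_ ?_ hR
        · constructor
          · intro i hi; unfold nrev; omega
          · intro j hj
            obtain ⟨x, hx, e⟩ := ht.2 (m-1-j) (by omega)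
            refine ⟨m-1-x, by omega, ?_⟩
            unfold nrev
            have e1 : m - 1 - (m - 1 - x) = x := by omega
            rw [e1, e]; omega
        · intro i hi j hj e
          unfold nrev at e
          have a1 := ht.1 (m-1-i) (by omega)
          have a2 := ht.1 (m-1-j) (by omega)
          have := injt (m-1-i) (by omega) (m-1-j) (by omega) (by omega)
          omega
        · intro i hi
          unfold nrev
          have e := h2 (m-1-i) (by omega)
          have a1 := ht.1 (m-1-i) (by omega)
          have e1 : k + (m - 1 - i) = k + m - 1 - i := by omega
          rw [e1] at e
          omega
        · intro i him hi
          unfold nrev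
          have e := h1 (k + m - 1 - i) (by omega)
          have := hs.1 (k + m - 1 - i) (by omega)
          omega
      refine NFull_congr ?_ (NFull_rev ?_ this)
      · intro i hi
        unfold nrev
        have e1 : m - 1 - (m - 1 - i) = i := by omega
        rw [e1]
        have := ht.1 i hi
        omega
      · intro i hi; unfold nrev; omega
  · rintro ⟨hS, hT⟩
    intro i hi j hj S hC hg
    have b1 : BoxIn S 0 k 0 k := by
      intro i j _ hi _ hj
      refine hS i hi j hj S ?_ ?_
      · intro i j i1 j1 i2 j2 a b c d e g q1 q2 x y z
        exact hC i j i1 j1 i2 j2 (by omega) (by omega) (by omega) (by omega) (by omega) (by omega) q1 q2 x y z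
      · intro x hx; rw [← h1 x hx]; exact hg x (by omega)
    have b2 : BoxIn S k (k+m) k (k+m) := by
      intro i j hi0 hi hj0 hj
      have := hT (i-k) (by omega) (j-k) (by omega) (fun x y => S (k+x) (k+y)) ?_ ?_
      · have e1 : k + (i - k) = i := by omega
        have e2 : k + (j - k) = j := by omega
        simpa only [e1, e2] using this
      · intro i j i1 j1 i2 j2 a b c d e g q1 q2 x y z
        refine hC _ _ _ _ _ _ (by omega) (by omega) (by omega) (by omega) (by omega) (by omega) q1 q2 ?_ ?_ ?_
          <;> (unfold NAdj at *; omega)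
      · intro x hx
        have := hg (k + x) (by omega)
        rwa [h2 x hx] at this
    have A : ∀ i j, k ≤ i → i < k + m → j < k → S i j := by
      intro i j q1 q2 q3
      exact corner hC 0 k 0 k k (k+m) k (k+m) (k-1) (k-1) k k (by omega) (by omega) le_rfl le_rfl b1 b2
        (by omega) (by omega) (by omega) (by omega) (by omega) (by omega) i j q1 q2 (by omega) q3
    have B : ∀ i j, i < k → k ≤ j → j < k + m → S i j := by
      intro i j q1 q2 q3
      exact corner hC k (k+m) k (k+m) 0 k 0 k k k (k-1) (k-1) le_rfl le_rfl (by omega) (by omega) b2 b1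
        (by omega) (by omega) (by omega) (by omega) (by omega) (by omega) i j (by omega) q1 q2 q3
    by_cases hik : i < k <;> by_cases hjk : j < k
    · exact b1 i j (by omega) hik (by omega) hjk
    · exact B i j hik (by omega) hj
    · exact A i j (by omega) hi hjk
    · exact b2 i j (by omega) hi (by omega) hj

def FF {n : ℕ} (π : Equiv.Perm (Fin n)) : ℕ → ℕ := fun i => if h : i < n then π ⟨i, h⟩ else 0

theorem FF_val {n : ℕ} (π : Equiv.Perm (Fin n)) (i : Fin n) : FF π i = π i := by
  simp [FF]

theorem FF_IsP {n : ℕ} (π : Equiv.Perm (Fin n)) : IsP n (FF π) := by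
  constructor
  · intro i hi
    simp [FF, hi]
  · intro j hj
    refine ⟨π.symm ⟨j, hj⟩, (π.symm ⟨j, hj⟩).2, ?_⟩
    rw [FF_val]; simp

theorem FF_inj {n : ℕ} (π : Equiv.Perm (Fin n)) : ∀ i < n, ∀ j < n, FF π i = FF π j → i = j := by
  intro i hi j hj h
  simp only [FF, hi, hj, dite_true] at h
  have := π.injective (Fin.ext h)
  simpa using this

theorem Full_iff {n : ℕ} (π : Equiv.Perm (Fin n)) : Full π ↔ NFull n (FF π) := by
  unfold Full percClosure
  rw [Set.eq_univ_iff_forall]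
  constructor
  · intro h i hi j hj S hS hg
    have := h (⟨i, hi⟩, ⟨j, hj⟩) {p | S p.1 p.2} ?_
    · exact this
    · constructor
      · rintro ⟨x, y⟩ hxy
        have hxy : y = π x := hxy
        subst hxy
        have := hg x x.2
        rw [FF_val] at this
        exact this
      · rintro c ⟨d, hd, e, he, hne, h1, h2⟩
        refine hS c.1 c.2 d.1 d.2 e.1 e.2 c.1.2 c.2.2 d.1.2 d.2.2 e.1.2 e.2.2 hd he ?_ ?_ ?_
        · unfold Adj at h1; unfold NAdj; simpa [Fin.ext_iff] using h1
        · unfold Adj at h2; unfold NAdj; simpa [Fin.ext_iff] using h2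
        · rintro ⟨u, v⟩
          exact hne (Prod.ext (Fin.ext u) (Fin.ext v))
  · rintro h ⟨i, j⟩ S ⟨hg, hS⟩
    have := h i i.2 j j.2 (fun x y => ∃ hx hy, ((⟨x, hx⟩, ⟨y, hy⟩) : Fin n × Fin n) ∈ S) ?_ ?_
    · obtain ⟨_, _, h⟩ := this
      exact h
    · rintro i j i1 j1 i2 j2 a b c d e g ⟨_, _, h1⟩ ⟨_, _, h2⟩ x y z
      refine ⟨a, b, hS _ ⟨_, h1, _, h2, ?_, ?_, ?_⟩⟩
      · intro hh
        simp at hh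
        exact z hh
      · unfold NAdj at x; unfold Adj; simpa using x
      · unfold NAdj at y; unfold Adj; simpa using y
    · intro x hx
      refine ⟨hx, (FF_IsP π).1 x hx, hg ?_⟩
      apply Fin.ext
      exact FF_val π ⟨x, hx⟩

def psum {k m : ℕ} (σ : Equiv.Perm (Fin k)) (τ : Equiv.Perm (Fin m)) : Equiv.Perm (Fin (k + m)) :=
  finSumFinEquiv.permCongr (Equiv.Perm.sumCongr σ τ)

theorem psum_left {k m : ℕ} (σ : Equiv.Perm (Fin k)) (τ : Equiv.Perm (Fin m)) (i : Fin k) :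
    psum σ τ (Fin.castAdd m i) = Fin.castAdd m (σ i) := by
  simp [psum, Equiv.permCongr_apply]

theorem psum_right {k m : ℕ} (σ : Equiv.Perm (Fin k)) (τ : Equiv.Perm (Fin m)) (i : Fin m) :
    psum σ τ (Fin.natAdd k i) = Fin.natAdd k (τ i) := by
  simp [psum, Equiv.permCongr_apply]

theorem FF_psum_left {k m : ℕ} (σ : Equiv.Perm (Fin k)) (τ : Equiv.Perm (Fin m)) :
    ∀ i < k, FF (psum σ τ) i = FF σ i := by
  intro i hi
  have h1 := FF_val (psum σ τ) (Fin.castAdd m ⟨i, hi⟩)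
  have h2 := FF_val σ ⟨i, hi⟩
  rw [psum_left] at h1
  simp at h1 h2
  rw [h1, h2]

theorem FF_psum_right {k m : ℕ} (σ : Equiv.Perm (Fin k)) (τ : Equiv.Perm (Fin m)) :
    ∀ i < m, FF (psum σ τ) (k + i) = k + FF τ i := by
  intro i hi
  have h1 := FF_val (psum σ τ) (Fin.natAdd k ⟨i, hi⟩)
  have h2 := FF_val τ ⟨i, hi⟩
  rw [psum_right] at h1
  simp at h1 h2
  rw [h1, h2]

theorem Full_psum {k m : ℕ} (σ : Equiv.Perm (Fin k)) (τ : Equiv.Perm (Fin m)) :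
    Full (psum σ τ) ↔ Full σ ∧ Full τ := by
  rw [Full_iff, Full_iff, Full_iff]
  exact NFull_sum (FF_IsP σ) (FF_inj σ) (FF_IsP τ) (FF_inj τ) (FF_psum_left σ τ) (FF_psum_right σ τ)

theorem psum_inj {k m : ℕ} {σ σ' : Equiv.Perm (Fin k)} {τ τ' : Equiv.Perm (Fin m)}
    (h : psum σ τ = psum σ' τ') : σ = σ' ∧ τ = τ' := by
  have h1 := (finSumFinEquiv (m := k) (n := m)).permCongr.injective h
  have := Equiv.Perm.sumCongrHom_injective (α := Fin k) (β := Fin m)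
    (a₁ := (σ, τ)) (a₂ := (σ', τ')) h1
  simpa using this

def Pres {n : ℕ} (π : Equiv.Perm (Fin n)) (k : ℕ) : Prop := ∀ i < k, i < n → FF π i < k

theorem Indec_iff {n : ℕ} (π : Equiv.Perm (Fin n)) :
    Indecomposable π ↔ ∀ k, 1 ≤ k → k < n → ¬ Pres π k := by
  unfold Indecomposable
  have key : ∀ k, ((fun i => π i) '' {i : Fin n | (i : ℕ) < k} = {i : Fin n | (i : ℕ) < k}) ↔ Pres π k := by
    intro k
    constructor
    · intro h i hik hin
      have : π ⟨i, hin⟩ ∈ {i : Fin n | (i : ℕ) < k} := by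
        rw [← h]; exact ⟨⟨i, hin⟩, hik, rfl⟩
      have e := FF_val π ⟨i, hin⟩
      simp only [Set.mem_setOf_eq] at this e
      omega
    · intro h
      apply Set.eq_of_subset_of_ncard_le
      · rintro _ ⟨i, hi, rfl⟩
        have := h i hi i.2
        rw [FF_val] at this
        exact this
      · rw [Set.ncard_image_of_injective _ π.injective]
      · exact Set.toFinite _
  simp only [key]
  push Not
  rfl

theorem exists_psum {k m : ℕ} (π : Equiv.Perm (Fin (k + m))) (h : Pres π k) :
    ∃ σ τ, psum σ τ = π := by
  have : (finSumFinEquiv (m := k) (n := m)).symm.permCongr π ∈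
      (Equiv.Perm.sumCongrHom (Fin k) (Fin m)).range := by
    apply Equiv.Perm.mem_sumCongrHom_range_of_perm_mapsTo_inl
    rintro _ ⟨i, rfl⟩
    have h1 := h i i.2 (by omega)
    have h2 := FF_val π (Fin.castAdd m i)
    simp only [Fin.val_castAdd] at h2
    rw [h2] at h1
    refine ⟨⟨π (Fin.castAdd m i), h1⟩, ?_⟩
    rw [Equiv.permCongr_apply, Equiv.eq_symm_apply]
    simp
  obtain ⟨⟨σ, τ⟩, e⟩ := this
  refine ⟨σ, τ, ?_⟩
  have e' : Equiv.Perm.sumCongr σ τ = (finSumFinEquiv (m := k) (n := m)).symm.permCongr π := e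
  unfold psum
  rw [e']
  ext x
  simp [Equiv.permCongr_apply]

theorem Pres_psum_le {k m : ℕ} (σ : Equiv.Perm (Fin k)) (τ : Equiv.Perm (Fin m)) (j : ℕ) (hj : j ≤ k) :
    Pres (psum σ τ) j ↔ Pres σ j := by
  unfold Pres
  constructor
  · intro h i hi hik
    rw [← FF_psum_left σ τ i hik]
    exact h i hi (by omega)
  · intro h i hi hik
    rw [FF_psum_left σ τ i (by omega)]
    exact h i hi (by omega)

theorem Pres_self {n : ℕ} (π : Equiv.Perm (Fin n)) : Pres π n := fun i hi _ => (FF_IsP π).1 i hi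

theorem first_ex {n : ℕ} (π : Equiv.Perm (Fin (n+1))) : ∃ k, 1 ≤ k ∧ Pres π k :=
  ⟨n+1, by omega, Pres_self π⟩

def IsFirst {n : ℕ} (π : Equiv.Perm (Fin n)) (k : ℕ) : Prop :=
  (1 ≤ k ∧ Pres π k) ∧ ∀ j, 1 ≤ j → j < k → ¬ Pres π j

theorem count_k (k m : ℕ) (hk : 1 ≤ k) :
    Nat.card {π : Equiv.Perm (Fin (k + m)) // Full π ∧ IsFirst π k} = numFullIndec k * numFull m := by
  unfold numFullIndec numFull
  rw [← Nat.card_prod]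
  symm
  have hF : ∀ (σ : Equiv.Perm (Fin k)) (τ : Equiv.Perm (Fin m)),
      IsFirst (psum σ τ) k ↔ Indecomposable σ := by
    intro σ τ
    rw [Indec_iff]
    constructor
    · intro h j h1 h2 h3
      exact h.2 j h1 h2 ((Pres_psum_le σ τ j h2.le).2 h3)
    · intro h
      exact ⟨⟨hk, (Pres_psum_le σ τ k le_rfl).2 (Pres_self σ)⟩,
        fun j h1 h2 h3 => h j h1 h2 ((Pres_psum_le σ τ j h2.le).1 h3)⟩
  refine Nat.card_congr (Equiv.ofBijective
    (fun p => ⟨psum p.1.1 p.2.1, (Full_psum _ _).2 ⟨p.1.2.1, p.2.2⟩, (hF _ _).2 p.1.2.2⟩) ⟨?_, ?_⟩)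
  · rintro ⟨⟨σ, hσ⟩, ⟨τ, hτ⟩⟩ ⟨⟨σ', hσ'⟩, ⟨τ', hτ'⟩⟩ h
    have := psum_inj (Subtype.ext_iff.1 h)
    obtain ⟨rfl, rfl⟩ := this
    rfl
  · rintro ⟨π, h1, h2⟩
    obtain ⟨σ, τ, rfl⟩ := exists_psum π h2.1.2
    have h3 := (Full_psum _ _).1 h1
    exact ⟨⟨⟨σ, h3.1, (hF _ _).1 h2⟩, ⟨τ, h3.2⟩⟩, rfl⟩

theorem count_top (n : ℕ) (hn : 1 ≤ n) :
    Nat.card {π : Equiv.Perm (Fin n) // Full π ∧ IsFirst π n} = numFullIndec n := by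
  unfold numFullIndec
  refine Nat.card_congr (Equiv.subtypeEquivRight ?_)
  intro π
  rw [Indec_iff]
  constructor
  · rintro ⟨h1, h2⟩
    exact ⟨h1, h2.2⟩
  · rintro ⟨h1, h2⟩
    exact ⟨h1, ⟨hn, Pres_self π⟩, h2⟩

open Classical in
theorem count_all (n : ℕ) :
    numFull (n+1) = ∑ k ∈ Finset.Icc 1 (n+1),
      Nat.card {π : Equiv.Perm (Fin (n+1)) // Full π ∧ IsFirst π k} := by
  unfold numFull
  rw [Nat.card_eq_fintype_card, Fintype.card_subtype,
    Finset.card_eq_sum_card_fiberwise (f := fun π => Nat.find (first_ex π)) (t := Finset.Icc 1 (n+1))]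
  · refine Finset.sum_congr rfl ?_
    intro k hk
    rw [Nat.card_eq_fintype_card, Fintype.card_subtype, Finset.filter_filter]
    congr 1
    ext π
    simp only [Finset.mem_filter, Finset.mem_univ, true_and]
    rw [Nat.find_eq_iff]
    unfold IsFirst
    constructor
    · rintro ⟨a, b, c⟩
      exact ⟨a, b, fun j h1 h2 h3 => c j h2 ⟨h1, h3⟩⟩
    · rintro ⟨a, b, c⟩
      exact ⟨a, b, fun j h2 h3 => c j h3.1 h2 h3.2⟩
  · intro π _
    simp only [Finset.coe_Icc, Set.mem_Icc]
    exact ⟨(Nat.find_spec (first_ex π)).1, Nat.find_min' (first_ex π) ⟨by omega, Pres_self π⟩⟩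

theorem full_one (π : Equiv.Perm (Fin 1)) : Full π := by
  rw [Full_iff]
  intro i hi j hj S _ hg
  have h := hg 0 (by omega)
  have h2 := (FF_IsP π).1 0 (by omega)
  have e : FF π 0 = j := by omega
  have e2 : i = 0 := by omega
  rw [e] at h
  rw [e2]
  exact h

theorem stmt_12 :
    numFull 1 = 1 ∧ numFullIndec 1 = 1 ∧
    ∀ n : ℕ, numFull (n + 2) = numFullIndec (n + 2) +
      ∑ k ∈ Finset.Icc 1 (n + 1), numFullIndec k * numFull (n + 2 - k) := by
  refine ⟨?_, ?_, ?_⟩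
  · unfold numFull
    rw [Nat.card_eq_one_iff_unique]
    exact ⟨inferInstance, ⟨⟨1, full_one 1⟩⟩⟩
  · unfold numFullIndec
    rw [Nat.card_eq_one_iff_unique]
    refine ⟨inferInstance, ⟨⟨1, full_one 1, ?_⟩⟩⟩
    rw [Indec_iff]
    intro k h1 h2; omega
  · intro n
    rw [count_all (n+1), Finset.sum_Icc_succ_top (by omega), count_top (n+1+1) (by omega), add_comm]
    congr 1
    refine Finset.sum_congr rfl ?_
    intro k hk
    rw [Finset.mem_Icc] at hk
    obtain ⟨m, hm⟩ : ∃ m, n + 1 + 1 = k + m := ⟨n + 2 - k, by omega⟩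
    have e : n + 2 - k = m := by omega
    rw [e, hm]
    exact count_k k m hk.1
end
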